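/- arXiv:2201.12077 — 6 statements merged into one kernel-verified Lean document; each statement's English description precedes it below -/
import Mathlib

section
/- Let δ ∈ (0, 1/2) and let R : {x ∈ ℝ³ : |x| > 1} → ℝ be C¹ with constants c > 0 such that |R(x)| ≤ c|x|⁻⁴ and |∇R(x)| ≤ c|x|⁻⁵ for all |x| > 1. Assume moreover that for every ε > 0 there exists ρ > 1 such that ∑_{i=1}^{3} xⁱ ∂ᵢ(|x|² R(x)) ≤ ε|x|⁻² and |R(x) − R(−x)| ≤ ε|x|⁻⁴ whenever |x| ≥ ρ. For λ > 2/δ and |ξ| < 1 − δ set G_{2,λ}(ξ) = 2λ ∫_{{x : |x − λξ| ≥ λ}} R(x) dx (a convergent Lebesgue integral). Then for every ε > 0 there exists λ₀ such that for all λ ≥ λ₀ and all ξ with 0 < |ξ| < 1 − δ one has |ξ|⁻¹ ⟨∇_ξ G_{2,λ}(ξ), ξ⟩ ≥ −ε. -/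
open MeasureTheory Metric

noncomputable abbrev E3 := EuclideanSpace ℝ (Fin 3)

/-- `G2 R lam ξ = 2 λ ∫_{{x : |x − λξ| ≥ λ}} R(x) dx`. -/
noncomputable def G2 (R : E3 → ℝ) (lam : ℝ) (ξ : E3) : ℝ :=
  2 * lam * ∫ x in {x : E3 | lam ≤ ‖x - lam • ξ‖}, R x

section Helpers
open Set Filter Topology
open scoped Pointwise

abbrev S2 := sphere (0 : E3) 1

theorem polar {f : E3 → ℝ} (hf : Integrable f) :
    Integrable (fun θ : S2 => ∫ s in Ioi (0:ℝ), s ^ 2 * f (s • (θ : E3))) (volume : Measure E3).toSphere ∧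
    ∫ x, f x = ∫ θ : S2, (∫ s in Ioi (0:ℝ), s ^ 2 * f (s • (θ : E3))) ∂(volume : Measure E3).toSphere := by
  have hdim : Module.finrank ℝ E3 - 1 = 2 := by simp
  have hmp := (volume : Measure E3).measurePreserving_homeomorphUnitSphereProd
  rw [hdim] at hmp
  have hme := (homeomorphUnitSphereProd E3).measurableEmbedding
  set g : S2 × Ioi (0:ℝ) → ℝ := fun p => f (p.2.1 • (p.1 : E3)) with hg
  have hcomp : (g ∘ homeomorphUnitSphereProd E3) = fun x => f x.1 := by
    funext x
    have h0 : ‖(x:E3)‖ ≠ 0 := by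
      have := x.2
      rw [norm_ne_zero_iff]; exact this
    simp [hg, smul_smul, h0]
  have hin : Integrable g ((volume : Measure E3).toSphere.prod (.volumeIoiPow 2)) := by
    rw [← hmp.integrable_comp_emb hme, hcomp]
    have := (integrableOn_iff_comap_subtypeVal (μ := (volume : Measure E3)) (f := f) (s := ({0}ᶜ : Set E3)) (by measurability)).1 hf.integrableOn
    exact this
  have hinner : ∀ θ : S2, ∫ s, g (θ, s) ∂(.volumeIoiPow 2) = ∫ s in Ioi (0:ℝ), s ^ 2 * f (s • (θ : E3)) := by
    intro θ
    simp only [Measure.volumeIoiPow, ENNReal.ofReal]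
    rw [integral_withDensity_eq_integral_smul]
    · rw [integral_subtype_comap measurableSet_Ioi (fun a : ℝ ↦ Real.toNNReal (a ^ 2) • f (a • (θ : E3)))]
      refine setIntegral_congr_fun measurableSet_Ioi fun x hx ↦ ?_
      rw [NNReal.smul_def, Real.coe_toNNReal _ (by positivity), smul_eq_mul]
    · exact (measurable_subtype_coe.pow_const _).real_toNNReal
  constructor
  · have := hin.integral_prod_left
    simpa only [hinner] using this
  · have h2 := hmp.integral_comp hme g
    rw [integral_prod _ hin] at h2
    simp only [hinner] at h2
    rw [← h2]
    have : (fun x => g (homeomorphUnitSphereProd E3 x)) = fun x => f x.1 := hcomp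
    rw [this, integral_subtype_comap (measurableSet_singleton _).compl f, restrict_compl_singleton]

theorem sphere_neg_mp : MeasurePreserving (fun θ : S2 => -θ) (volume : Measure E3).toSphere (volume : Measure E3).toSphere := by
  have hm : Measurable (fun θ : S2 => -θ) := continuous_neg.measurable
  refine ⟨hm, ?_⟩
  ext s hs
  rw [Measure.map_apply hm hs, Measure.toSphere_apply' _ hs, Measure.toSphere_apply' _ (hm hs)]
  congr 1
  rw [← Measure.measure_neg volume (Ioo (0:ℝ) 1 • ((↑) '' s : Set E3))]
  congr 1
  ext x
  simp only [Set.mem_smul, Set.mem_neg, Set.mem_image, mem_preimage]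
  constructor
  · rintro ⟨t, ht, _, ⟨θ, hθ, rfl⟩, rfl⟩
    exact ⟨t, ht, _, ⟨-θ, hθ, rfl⟩, by simp⟩
  · rintro ⟨t, ht, _, ⟨θ, hθ, rfl⟩, h⟩
    refine ⟨t, ht, _, ⟨-θ, by simpa using hθ, rfl⟩, ?_⟩
    simp only [Metric.sphere]
    rw [← neg_neg x, ← h]; simp

noncomputable def ww (ξ θ : E3) : ℝ := Real.sqrt (1 - ‖ξ‖ ^ 2 + (inner ℝ ξ θ) ^ 2)
noncomputable def rr (ξ θ : E3) : ℝ := inner ℝ ξ θ + ww ξ θ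

theorem ww_sq {ξ θ : E3} (h : ‖ξ‖ < 1) : ww ξ θ ^ 2 = 1 - ‖ξ‖ ^ 2 + (inner ℝ ξ θ) ^ 2 := by
  unfold ww
  rw [Real.sq_sqrt]
  nlinarith [norm_nonneg ξ, sq_nonneg (inner ℝ ξ θ)]

theorem abs_inner_lt_ww {ξ θ : E3} (h : ‖ξ‖ < 1) : |inner ℝ ξ θ| < ww ξ θ := by
  apply Real.lt_sqrt_of_sq_lt
  rw [sq_abs]
  nlinarith [norm_nonneg ξ]

theorem ww_pos {ξ θ : E3} (h : ‖ξ‖ < 1) : 0 < ww ξ θ := (abs_nonneg _).trans_lt (abs_inner_lt_ww h)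

theorem abs_inner_le {ξ θ : E3} (hθ : ‖θ‖ = 1) : |inner ℝ ξ θ| ≤ ‖ξ‖ := by
  simpa [hθ] using abs_real_inner_le_norm ξ θ

theorem delta_le_ww {δ : ℝ} {ξ θ : E3} (hδ : 0 < δ) (h : ‖ξ‖ < 1 - δ) : δ ≤ ww ξ θ := by
  apply Real.le_sqrt_of_sq_le
  nlinarith [norm_nonneg ξ, sq_nonneg (inner ℝ ξ θ)]

theorem rr_gt {δ : ℝ} {ξ θ : E3} (hδ : 0 < δ) (h : ‖ξ‖ < 1 - δ) (hθ : ‖θ‖ = 1) : δ < rr ξ θ := by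
  have h1 : ‖ξ‖ < 1 := by linarith
  have := abs_inner_le (ξ := ξ) hθ
  have h2 := ww_sq (θ := θ) h1
  have h3 := ww_pos (θ := θ) h1
  have h4 := abs_le.1 this
  unfold rr
  set a : ℝ := inner ℝ ξ θ
  have h5 := norm_nonneg ξ
  -- w > δ - a
  have : δ - a < ww ξ θ := by
    apply lt_of_pow_lt_pow_left₀ 2 h3.le
    rw [h2]
    nlinarith
  linarith

theorem geom {ξ θ : E3} (h : ‖ξ‖ < 1) (hθ : ‖θ‖ = 1) {lam s : ℝ} (hl : 0 < lam) (hs : 0 < s) :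
    lam ≤ ‖s • θ - lam • ξ‖ ↔ lam * rr ξ θ ≤ s := by
  have h2 := ww_sq (θ := θ) h
  have h3 := abs_lt.1 (abs_inner_lt_ww (θ := θ) h)
  have e : ‖s • θ - lam • ξ‖ ^ 2 = (s - lam * inner ℝ ξ θ) ^ 2 + lam ^ 2 - (lam * ww ξ θ) ^ 2 := by
    rw [norm_sub_sq_real, norm_smul, norm_smul, inner_smul_left, inner_smul_right, hθ, real_inner_comm, mul_pow lam, h2]
    simp only [Real.norm_eq_abs, mul_pow, sq_abs, RCLike.conj_to_real]
    ring
  rw [← abs_of_pos hl, ← abs_of_nonneg (norm_nonneg (_ - _)), ← sq_le_sq, abs_of_pos hl, e]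
  unfold rr
  set a : ℝ := inner ℝ ξ θ
  set w := ww ξ θ
  have hw : 0 < lam * w := mul_pos hl (ww_pos h)
  have ha : lam * a < lam * w := by gcongr; exact h3.2
  constructor
  · intro H
    by_contra! H'
    nlinarith
  · intro H
    nlinarith


theorem ray_norm {θ : E3} (hθ : ‖θ‖ = 1) {s : ℝ} (hs : 0 < s) : ‖s • θ‖ = s := by
  rw [norm_smul, hθ, mul_one, Real.norm_of_nonneg hs.le]

theorem isOpen_ext : IsOpen {x : E3 | 1 < ‖x‖} := isOpen_lt continuous_const continuous_norm

theorem ray_cont {R : E3 → ℝ} (hR : ContinuousOn R {x : E3 | 1 < ‖x‖}) {θ : E3} (hθ : ‖θ‖ = 1)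
    {s : ℝ} (hs : 1 < s) : ContinuousAt (fun s : ℝ => s ^ 2 * R (s • θ)) s := by
  have h1 : ContinuousAt R (s • θ) := hR.continuousAt (isOpen_ext.mem_nhds (by
    simp only [mem_ofPred_eq]; rw [ray_norm hθ (by linarith)]; exact hs))
  have h2 : ContinuousAt (fun s : ℝ => s • θ) s := by fun_prop
  exact (continuousAt_id.pow 2).mul (ContinuousAt.comp (f := fun s : ℝ => s • θ) h1 h2)

theorem ray_bound {R : E3 → ℝ} {c : ℝ} (hRb : ∀ x : E3, 1 < ‖x‖ → |R x| ≤ c * ‖x‖⁻¹ ^ 4)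
    {θ : E3} (hθ : ‖θ‖ = 1) {s : ℝ} (hs : 1 < s) : |s ^ 2 * R (s • θ)| ≤ c * s⁻¹ ^ 2 := by
  have h0 : 0 < s := by linarith
  have := hRb (s • θ) (by rw [ray_norm hθ h0]; exact hs)
  rw [ray_norm hθ h0] at this
  rw [abs_mul, abs_of_nonneg (sq_nonneg s)]
  calc s ^ 2 * |R (s • θ)| ≤ s ^ 2 * (c * s⁻¹ ^ 4) := by gcongr
    _ = c * s⁻¹ ^ 2 := by field_simp

theorem ray_int {R : E3 → ℝ} {c : ℝ} (hR : ContinuousOn R {x : E3 | 1 < ‖x‖})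
    (hRb : ∀ x : E3, 1 < ‖x‖ → |R x| ≤ c * ‖x‖⁻¹ ^ 4) {θ : E3} (hθ : ‖θ‖ = 1)
    {t : ℝ} (ht : 1 < t) : IntegrableOn (fun s : ℝ => s ^ 2 * R (s • θ)) (Ioi t) := by
  have h1 : IntegrableOn (fun s : ℝ => c * s ^ (-2 : ℝ)) (Ioi t) :=
    (integrableOn_Ioi_rpow_of_lt (by norm_num) (by linarith)).const_mul c
  refine Integrable.mono' h1 ?_ ?_
  · exact ContinuousOn.aestronglyMeasurable
      (fun s hs => (ray_cont hR hθ (ht.trans hs)).continuousWithinAt) measurableSet_Ioi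
  · filter_upwards [ae_restrict_mem measurableSet_Ioi] with s hs
    have hs1 : 1 < s := ht.trans hs
    refine (ray_bound hRb hθ hs1).trans (le_of_eq ?_)
    rw [Real.rpow_neg (by linarith)]
    norm_num

theorem ray_deriv {R : E3 → ℝ} {c : ℝ} (hR : ContinuousOn R {x : E3 | 1 < ‖x‖})
    (hRb : ∀ x : E3, 1 < ‖x‖ → |R x| ≤ c * ‖x‖⁻¹ ^ 4) {θ : E3} (hθ : ‖θ‖ = 1)
    {t : ℝ} (ht : 1 < t) :
    HasDerivAt (fun t : ℝ => ∫ s in Ioi t, s ^ 2 * R (s • θ)) (-(t ^ 2 * R (t • θ))) t := by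
  obtain ⟨a, ha1, hat⟩ := exists_between ht
  have hia := ray_int hR hRb hθ ha1
  have h1 : HasDerivAt (fun u : ℝ => ∫ s in a..u, s ^ 2 * R (s • θ)) (t ^ 2 * R (t • θ)) t := by
    apply intervalIntegral.integral_hasDerivAt_right
    · rw [intervalIntegrable_iff_integrableOn_Ioc_of_le hat.le]
      exact hia.mono_set Ioc_subset_Ioi_self
    · refine ⟨Ioi a, Ioi_mem_nhds hat, hia.aestronglyMeasurable⟩
    · exact ray_cont hR hθ ht
  have h2 := (h1.const_sub (∫ s in Ioi a, s ^ 2 * R (s • θ)))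
  refine h2.congr_of_eventuallyEq ?_
  filter_upwards [Ioi_mem_nhds hat] with u hu
  rw [← intervalIntegral.integral_Ioi_sub_Ioi hia (le_of_lt hu)]
  ring

theorem R_int {R : E3 → ℝ} {c : ℝ} (hR : ContinuousOn R {x : E3 | 1 < ‖x‖})
    (hc : 0 < c)
    (hRb : ∀ x : E3, 1 < ‖x‖ → |R x| ≤ c * ‖x‖⁻¹ ^ 4) : IntegrableOn R {x : E3 | 1 < ‖x‖} := by
  have h1 : Integrable (fun x : E3 => (16 * c) * (1 + ‖x‖) ^ (-4 : ℝ)) :=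
    (integrable_one_add_norm (by simp; norm_num)).const_mul _
  refine Integrable.mono' h1.integrableOn (hR.aestronglyMeasurable isOpen_ext.measurableSet) ?_
  filter_upwards [ae_restrict_mem isOpen_ext.measurableSet] with x hx
  have hx : 1 < ‖x‖ := hx
  refine (hRb x hx).trans ?_
  rw [Real.rpow_neg (by positivity)]
  have e : (1 + ‖x‖) ^ (4:ℝ) = (1 + ‖x‖) ^ 4 := by norm_cast
  rw [e]
  have h0 : 0 < ‖x‖ := by linarith
  have : (1 + ‖x‖) ^ 4 ≤ (2 * ‖x‖) ^ 4 := by gcongr; linarith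
  calc c * ‖x‖⁻¹ ^ 4 = 16 * c * ((2 * ‖x‖) ^ 4)⁻¹ := by field_simp; norm_num
    _ ≤ _ := by gcongr

theorem sub_ext {δ lam : ℝ} {ξ : E3} (hl : 0 < lam) (h1 : 1 < lam * δ) (h : ‖ξ‖ < 1 - δ) :
    {x : E3 | lam ≤ ‖x - lam • ξ‖} ⊆ {x : E3 | 1 < ‖x‖} := by
  intro x hx
  simp only [mem_ofPred_eq] at hx ⊢
  have := norm_sub_le x (lam • ξ)
  rw [norm_smul, Real.norm_of_nonneg hl.le] at this
  nlinarith

noncomputable def rrD (ξ θ : E3) : E3 →L[ℝ] ℝ :=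
  (1 + inner ℝ ξ θ / ww ξ θ) • innerSL ℝ θ - (1 / ww ξ θ) • innerSL ℝ ξ

theorem rr_hasFDerivAt {ξ θ : E3} (h : ‖ξ‖ < 1) : HasFDerivAt (fun ξ => rr ξ θ) (rrD ξ θ) ξ := by
  have h1 : HasFDerivAt (fun ξ : E3 => (inner ℝ ξ θ : ℝ)) (innerSL ℝ θ) ξ := by
    have := (innerSL ℝ θ).hasFDerivAt (x := ξ)
    refine this.congr_of_eventuallyEq (Eventually.of_forall fun y => ?_)
    simp [real_inner_comm]
  have h2 : HasFDerivAt (fun ξ : E3 => ‖ξ‖ ^ 2) (2 • innerSL ℝ ξ) ξ := (hasStrictFDerivAt_norm_sq ξ).hasFDerivAt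
  have hw := ww_pos (θ := θ) h
  have hw2 := ww_sq (θ := θ) h
  have h3 := (h1.add (((h2.const_sub 1).add (h1.pow 2)).sqrt (by
    have : 0 < 1 - ‖ξ‖ ^ 2 + (inner ℝ ξ θ) ^ 2 := by rw [← hw2]; positivity
    exact this.ne')))
  refine HasFDerivAt.congr_fderiv (f := fun ξ => rr ξ θ) h3 ?_
  have e : Real.sqrt (1 - ‖ξ‖ ^ 2 + (inner ℝ ξ θ) ^ 2) = ww ξ θ := rfl
  ext v
  simp [rrD, e]
  field_simp
  ring

theorem rrD_self {ξ θ : E3} : rrD ξ θ ξ = inner ℝ ξ θ + ((inner ℝ ξ θ) ^ 2 - ‖ξ‖ ^ 2) / ww ξ θ := by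
  simp [rrD, real_inner_comm]
  ring

theorem rrD_norm {δ : ℝ} {ξ θ : E3} (hδ : 0 < δ) (h : ‖ξ‖ < 1 - δ) (hθ : ‖θ‖ = 1) : ‖rrD ξ θ‖ ≤ 2 + 1 / δ := by
  have h1 : ‖ξ‖ < 1 := by linarith
  have hw := ww_pos (θ := θ) h1
  have h2 := abs_inner_lt_ww (θ := θ) h1
  unfold rrD
  refine (norm_sub_le _ _).trans ?_
  rw [norm_smul, norm_smul, innerSL_apply_norm, innerSL_apply_norm, hθ, mul_one]
  gcongr
  · refine (norm_add_le _ _).trans ?_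
    rw [norm_div, norm_one, Real.norm_eq_abs, Real.norm_of_nonneg hw.le]
    have : |inner ℝ ξ θ| / ww ξ θ ≤ 1 := by rw [div_le_one hw]; exact h2.le
    linarith
  · rw [Real.norm_of_nonneg (by positivity)]
    calc 1 / ww ξ θ * ‖ξ‖ ≤ 1 / δ * 1 := by
          gcongr
          exact delta_le_ww hδ h
      _ = _ := mul_one _

theorem G2_polar {R : E3 → ℝ} {c δ lam : ℝ} (hR : ContinuousOn R {x : E3 | 1 < ‖x‖})
    (hc : 0 < c) (hRb : ∀ x : E3, 1 < ‖x‖ → |R x| ≤ c * ‖x‖⁻¹ ^ 4)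
    (hδ : 0 < δ) (hl : 0 < lam) (h1 : 1 < lam * δ) {ξ : E3} (h : ‖ξ‖ < 1 - δ) :
    Integrable (fun θ : S2 => ∫ s in Ioi (lam * rr ξ θ), s ^ 2 * R (s • (θ : E3)))
      (volume : Measure E3).toSphere ∧
    ∫ x in {x : E3 | lam ≤ ‖x - lam • ξ‖}, R x =
      ∫ θ : S2, (∫ s in Ioi (lam * rr ξ θ), s ^ 2 * R (s • (θ : E3)))
        ∂(volume : Measure E3).toSphere := by
  have hm : MeasurableSet {x : E3 | lam ≤ ‖x - lam • ξ‖} :=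
    (isClosed_le continuous_const (by fun_prop)).measurableSet
  have hi : IntegrableOn R {x : E3 | lam ≤ ‖x - lam • ξ‖} :=
    (R_int hR hc hRb).mono_set (sub_ext hl h1 h)
  have hp := polar (hi.integrable_indicator hm)
  rw [integral_indicator hm] at hp
  have key : ∀ θ : S2, ∫ s in Ioi (0:ℝ), s ^ 2 * ({x : E3 | lam ≤ ‖x - lam • ξ‖}.indicator R) (s • (θ : E3))
      = ∫ s in Ioi (lam * rr ξ θ), s ^ 2 * R (s • (θ : E3)) := by
    intro θ
    have hθ : ‖(θ:E3)‖ = 1 := by simp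
    have hr : 0 < lam * rr ξ θ := mul_pos hl (hδ.trans (rr_gt hδ h hθ))
    have e : ∫ s in Ioi (0:ℝ), s ^ 2 * ({x : E3 | lam ≤ ‖x - lam • ξ‖}.indicator R) (s • (θ : E3))
      = ∫ s in Ioi (0:ℝ), (Ici (lam * rr ξ θ)).indicator (fun s => s ^ 2 * R (s • (θ : E3))) s := by
      refine setIntegral_congr_fun measurableSet_Ioi fun s hs ↦ ?_
      have hg := geom (ξ := ξ) (by linarith) hθ hl hs
      by_cases hh : lam * rr ξ θ ≤ s
      · rw [indicator_of_mem (show s ∈ Ici (lam * rr ξ θ) from hh), indicator_of_mem]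
        exact hg.2 hh
      · rw [indicator_of_notMem (show s ∉ Ici (lam * rr ξ θ) from hh), indicator_of_notMem, mul_zero]
        exact fun hx => hh (hg.1 hx)
    rw [e, setIntegral_indicator measurableSet_Ici, ← integral_Ici_eq_integral_Ioi]
    congr 2
    ext s
    simp only [mem_inter_iff, mem_Ioi, mem_Ici]
    exact ⟨fun h => h.2, fun h => ⟨hr.trans_le h, h⟩⟩
  simpa only [key] using hp

noncomputable def HD (R : E3 → ℝ) (lam : ℝ) (ξ θ : E3) : E3 →L[ℝ] ℝ :=
  (-((lam * rr ξ θ) ^ 2 * R ((lam * rr ξ θ) • θ)) * lam) • rrD ξ θ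

theorem HD_cont {R : E3 → ℝ} {δ lam : ℝ} (hR : ContinuousOn R {x : E3 | 1 < ‖x‖})
    (hδ : 0 < δ) (hl : 0 < lam) (h1 : 1 < lam * δ) {ξ : E3} (h : ‖ξ‖ < 1 - δ) :
    Continuous (fun θ : S2 => HD R lam ξ θ) := by
  have hw : Continuous (fun θ : S2 => ww ξ θ) := by unfold ww; fun_prop
  have hr : Continuous (fun θ : S2 => rr ξ θ) := by
    unfold rr; exact Continuous.add (by fun_prop) hw
  have hw0 : ∀ θ : S2, ww ξ θ ≠ 0 := fun θ => (ww_pos (by linarith)).ne'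
  have hD : Continuous (fun θ : S2 => rrD ξ θ) := by
    unfold rrD
    have h3 : Continuous (fun θ : S2 => innerSL ℝ (θ : E3)) :=
      (innerSL ℝ).continuous.comp continuous_subtype_val
    have h4 : Continuous (fun θ : S2 => (inner ℝ ξ (θ : E3) : ℝ)) := by fun_prop
    exact ((continuous_const.add (h4.div hw hw0)).smul h3).sub
      ((continuous_const.div hw hw0).smul continuous_const)
  have hRc : Continuous (fun θ : S2 => R ((lam * rr ξ θ) • (θ : E3))) := by
    refine hR.comp_continuous (f := fun θ : S2 => (lam * rr ξ θ) • (θ : E3))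
      ((continuous_const.mul hr).smul continuous_subtype_val) ?_
    intro θ
    have hθ : ‖(θ:E3)‖ = 1 := by simp
    have hg := rr_gt hδ h hθ
    have : lam * δ < lam * rr ξ θ := by gcongr
    show 1 < ‖(lam * rr ξ θ) • (θ : E3)‖
    rw [ray_norm hθ (by linarith)]
    linarith
  unfold HD
  exact ((((continuous_const.mul hr).pow 2).mul hRc).neg.mul continuous_const).smul hD

theorem G2_deriv {R : E3 → ℝ} {c δ lam : ℝ} (hR : ContinuousOn R {x : E3 | 1 < ‖x‖})
    (hc : 0 < c) (hRb : ∀ x : E3, 1 < ‖x‖ → |R x| ≤ c * ‖x‖⁻¹ ^ 4)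
    (hδ : 0 < δ) (hl : 0 < lam) (h1 : 1 < lam * δ) {ξ : E3} (h : ‖ξ‖ < 1 - δ) :
    HasFDerivAt (G2 R lam)
      ((2 * lam) • ∫ θ : S2, HD R lam ξ θ ∂(volume : Measure E3).toSphere) ξ := by
  have hs : {y : E3 | ‖y‖ < 1 - δ} ∈ 𝓝 ξ :=
    (isOpen_lt continuous_norm continuous_const).mem_nhds h
  have hgt : ∀ θ : S2, ∀ y : E3, ‖y‖ < 1 - δ → 1 < lam * rr y θ := by
    intro θ y hy
    have hθ : ‖(θ:E3)‖ = 1 := by simp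
    have hg := rr_gt hδ hy hθ
    have : lam * δ < lam * rr y θ := by gcongr
    linarith
  have key := hasFDerivAt_integral_of_dominated_of_fderiv_le
    (μ := (volume : Measure E3).toSphere)
    (F := fun (y : E3) (θ : S2) => ∫ s in Ioi (lam * rr y θ), s ^ 2 * R (s • (θ : E3)))
    (F' := fun (y : E3) (θ : S2) => HD R lam y θ)
    (bound := fun _ => c * lam * (2 + 1 / δ)) hs
    (by
      filter_upwards [hs] with y hy
      exact (G2_polar hR hc hRb hδ hl h1 hy).1.aestronglyMeasurable)
    (G2_polar hR hc hRb hδ hl h1 h).1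
    (HD_cont hR hδ hl h1 h).aestronglyMeasurable
    (by
      refine Eventually.of_forall fun θ y hy => ?_
      have hθ : ‖(θ:E3)‖ = 1 := by simp
      have hg := hgt θ y hy
      have hb := ray_bound hRb hθ hg
      have hb2 : c * (lam * rr y θ)⁻¹ ^ 2 ≤ c := by
        have : (lam * rr y θ)⁻¹ ^ 2 ≤ 1 :=
          pow_le_one₀ (by positivity) (inv_le_one_of_one_le₀ hg.le)
        nlinarith
      show ‖HD R lam y θ‖ ≤ _
      unfold HD
      rw [norm_smul, norm_mul, norm_neg, Real.norm_of_nonneg hl.le, Real.norm_eq_abs]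
      gcongr
      · exact hb.trans hb2
      · exact rrD_norm hδ hy hθ)
    (integrable_const _)
    (by
      refine Eventually.of_forall fun θ y hy => ?_
      have hθ : ‖(θ:E3)‖ = 1 := by simp
      have hd := ray_deriv hR hRb hθ (hgt θ y hy)
      have hy' : ‖y‖ < 1 - δ := hy
      have hr := (rr_hasFDerivAt (ξ := y) (θ := θ) (by linarith)).const_mul lam
      have := HasDerivAt.comp_hasFDerivAt (f := fun y => lam * rr y θ) y hd hr
      refine this.congr_fderiv ?_
      unfold HD
      rw [smul_smul])
  refine (key.const_mul (2 * lam)).congr_of_eventuallyEq ?_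
  filter_upwards [hs] with y hy
  simp only [G2]
  rw [(G2_polar hR hc hRb hδ hl h1 hy).2]

theorem sum_fderiv (L : E3 →L[ℝ] ℝ) (x : E3) :
    ∑ i : Fin 3, x i * L (EuclideanSpace.single i 1) = L x := by
  have : x = ∑ i : Fin 3, x i • (EuclideanSpace.single i (1:ℝ) : E3) := by
    ext j
    fin_cases j <;> simp [Fin.sum_univ_three]
  conv_rhs => rw [this]
  simp [map_sum]

theorem ray_anti {R : E3 → ℝ} {η ρ : ℝ}
    (hR : ContDiffOn ℝ 1 R {x : E3 | 1 < ‖x‖}) (hρ : 1 < ρ)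
    (has : ∀ x : E3, ρ ≤ ‖x‖ → ∑ i : Fin 3,
          x i * fderiv ℝ (fun y : E3 => ‖y‖ ^ 2 * R y) x (EuclideanSpace.single i 1)
            ≤ η * ‖x‖⁻¹ ^ 2) {θ : E3} (hθ : ‖θ‖ = 1) :
    AntitoneOn (fun s : ℝ => s ^ 2 * R (s • θ) + η / 2 * s⁻¹ ^ 2) (Ici ρ) := by
  have hd : ∀ s : ℝ, ρ ≤ s → ∃ g' : ℝ, s * g' ≤ η * s⁻¹ ^ 2 ∧
      HasDerivAt (fun s : ℝ => s ^ 2 * R (s • θ)) g' s := by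
    intro s hs
    have hs0 : 0 < s := by linarith
    have hn := ray_norm hθ hs0
    have h1 := has (s • θ) (by rw [hn]; exact hs)
    rw [sum_fderiv, hn, map_smul] at h1
    refine ⟨_, h1, ?_⟩
    have hRd : DifferentiableAt ℝ R (s • θ) :=
      (hR.differentiableOn one_ne_zero).differentiableAt (isOpen_ext.mem_nhds (by
        show 1 < ‖s • θ‖
        rw [hn]; linarith))
    have hF : DifferentiableAt ℝ (fun y : E3 => ‖y‖ ^ 2 * R y) (s • θ) :=
      (hasStrictFDerivAt_norm_sq (s • θ)).hasFDerivAt.differentiableAt.mul hRd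
    have hl : HasDerivAt (fun s : ℝ => s • θ) θ s := by
      simpa using (hasDerivAt_id s).smul_const θ
    have := HasFDerivAt.comp_hasDerivAt (f := fun s : ℝ => s • θ) s hF.hasFDerivAt hl
    refine this.congr_of_eventuallyEq (Eventually.of_forall fun u => ?_)
    simp [norm_smul, hθ]
  have hd2 : ∀ s : ℝ, ρ ≤ s → ∃ h' : ℝ, h' ≤ 0 ∧
      HasDerivAt (fun s : ℝ => s ^ 2 * R (s • θ) + η / 2 * s⁻¹ ^ 2) h' s := by
    intro s hs
    have hs0 : 0 < s := by linarith
    obtain ⟨g', h1, h2⟩ := hd s hs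
    have h3 := h2.add (((hasDerivAt_inv hs0.ne').pow 2).const_mul (η / 2))
    refine ⟨_, ?_, h3⟩
    have : g' ≤ η * s⁻¹ ^ 3 := by
      have := mul_le_mul_of_nonneg_left h1 (inv_pos.2 hs0).le
      calc g' = s⁻¹ * (s * g') := by field_simp
        _ ≤ _ := this
        _ = _ := by ring
    have e : η / 2 * (((2:ℕ):ℝ) * s⁻¹ ^ (2 - 1) * -(s ^ 2)⁻¹) = - (η * s⁻¹ ^ 3) := by
      rw [← inv_pow]
      norm_num
      ring
    rw [e]
    linarith
  refine antitoneOn_of_deriv_nonpos (convex_Ici ρ) ?_ ?_ ?_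
  · intro s hs
    obtain ⟨_, _, h⟩ := hd2 s hs
    exact h.continuousAt.continuousWithinAt
  · intro s hs
    rw [interior_Ici] at hs
    obtain ⟨_, _, h⟩ := hd2 s (le_of_lt hs)
    exact h.differentiableAt.differentiableWithinAt
  · intro s hs
    rw [interior_Ici] at hs
    obtain ⟨_, h0, h⟩ := hd2 s (le_of_lt hs)
    rw [h.deriv]
    exact h0

theorem ray_lower {R : E3 → ℝ} {η ρ c : ℝ} (hρ : 1 < ρ)
    (hRb : ∀ x : E3, 1 < ‖x‖ → |R x| ≤ c * ‖x‖⁻¹ ^ 4) {θ : E3} (hθ : ‖θ‖ = 1)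
    (ha : AntitoneOn (fun s : ℝ => s ^ 2 * R (s • θ) + η / 2 * s⁻¹ ^ 2) (Ici ρ))
    {s : ℝ} (hs : ρ ≤ s) : -(η / 2 * s⁻¹ ^ 2) ≤ s ^ 2 * R (s • θ) := by
  have hz : Tendsto (fun s : ℝ => s⁻¹ ^ 2) atTop (𝓝 0) := by
    simpa using (tendsto_inv_atTop_zero (𝕜 := ℝ)).pow 2
  have h1 : Tendsto (fun s : ℝ => s ^ 2 * R (s • θ)) atTop (𝓝 0) := by
    refine squeeze_zero_norm' (a := fun s : ℝ => c * s⁻¹ ^ 2) ?_ (by simpa using hz.const_mul c)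
    filter_upwards [eventually_gt_atTop 1] with u hu
    exact ray_bound hRb hθ hu
  have h2 : Tendsto (fun s : ℝ => s ^ 2 * R (s • θ) + η / 2 * s⁻¹ ^ 2) atTop (𝓝 0) := by
    simpa using h1.add (hz.const_mul (η / 2))
  have h3 := le_of_tendsto h2 (b := s ^ 2 * R (s • θ) + η / 2 * s⁻¹ ^ 2) (by
    filter_upwards [eventually_ge_atTop s] with u hu
    exact ha hs (hs.trans hu) hu)
  linarith

theorem ww_neg {ξ θ : E3} : ww ξ (-θ) = ww ξ θ := by simp [ww]

theorem pointwise {R : E3 → ℝ} {η ρ c δ lam : ℝ} (hη : 0 < η)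
    (hR : ContDiffOn ℝ 1 R {x : E3 | 1 < ‖x‖}) (hρ : 1 < ρ)
    (hRb : ∀ x : E3, 1 < ‖x‖ → |R x| ≤ c * ‖x‖⁻¹ ^ 4)
    (hasym : ∀ x : E3, ρ ≤ ‖x‖ →
      (∑ i : Fin 3,
          x i * fderiv ℝ (fun y : E3 => ‖y‖ ^ 2 * R y) x (EuclideanSpace.single i 1)
            ≤ η * ‖x‖⁻¹ ^ 2) ∧
        |R x - R (-x)| ≤ η * ‖x‖⁻¹ ^ 4)
    (hδ : 0 < δ) (hl : 0 < lam) (h1 : ρ ≤ lam * δ) {ξ : E3} (h : ‖ξ‖ < 1 - δ)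
    {θ : E3} (hθ : ‖θ‖ = 1) :
    (lam * rr ξ θ) ^ 2 * R ((lam * rr ξ θ) • θ) * rrD ξ θ ξ +
    (lam * rr ξ (-θ)) ^ 2 * R ((lam * rr ξ (-θ)) • (-θ)) * rrD ξ (-θ) ξ
      ≤ ‖ξ‖ * (η * (lam * δ)⁻¹ ^ 2 * (3 / 2 + 1 / δ)) := by
  wlog ha : 0 ≤ (inner ℝ ξ θ : ℝ) generalizing θ
  · have := this (θ := -θ) (by simpa using hθ) (by
      rw [inner_neg_right]; linarith)
    rw [neg_neg] at this
    linarith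
  have hθ' : ‖-θ‖ = 1 := by simpa using hθ
  have hξ1 : ‖ξ‖ < 1 := by linarith
  have hld : 0 < lam * δ := by positivity
  have hA := ray_anti hR hρ (fun x hx => (hasym x hx).1) hθ
  have hA' := ray_anti hR hρ (fun x hx => (hasym x hx).1) hθ'
  have hge : ∀ {θ : E3}, ‖θ‖ = 1 → lam * δ ≤ lam * rr ξ θ := by
    intro θ hθ
    have := rr_gt hδ h hθ
    gcongr
  have hp := hge hθ
  have hm := hge hθ'
  have hLp := ray_lower hρ hRb hθ hA (h1.trans hp)
  have hLm := ray_lower hρ hRb hθ' hA' (h1.trans hm)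
  have hmp : lam * rr ξ (-θ) ≤ lam * rr ξ θ := by
    unfold rr
    rw [ww_neg, inner_neg_right]
    gcongr
    linarith
  have hmono := hA (h1.trans hm) (h1.trans hp) hmp
  simp only at hmono
  have hinv : ∀ {s : ℝ}, lam * δ ≤ s → s⁻¹ ^ 2 ≤ (lam * δ)⁻¹ ^ 2 := by
    intro s hs
    have : 0 < s := by linarith
    gcongr
  have hip := hinv hp
  have him := hinv hm
  have hm0 : 0 < lam * rr ξ (-θ) := by linarith
  have hsym : (lam * rr ξ (-θ)) ^ 2 * R ((lam * rr ξ (-θ)) • θ) -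
      (lam * rr ξ (-θ)) ^ 2 * R ((lam * rr ξ (-θ)) • (-θ)) ≤ η * (lam * rr ξ (-θ))⁻¹ ^ 2 := by
    have h2 := (hasym ((lam * rr ξ (-θ)) • θ) (by rw [ray_norm hθ hm0]; linarith)).2
    rw [ray_norm hθ hm0, ← smul_neg] at h2
    have h3 := (le_abs_self _).trans h2
    rw [← mul_sub]
    calc _ ≤ (lam * rr ξ (-θ)) ^ 2 * (η * (lam * rr ξ (-θ))⁻¹ ^ 4) := by gcongr
      _ = _ := by field_simp
  rw [rrD_self, rrD_self, ww_neg, inner_neg_right]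
  have hal := abs_inner_le (ξ := ξ) hθ
  rw [abs_of_nonneg ha] at hal
  have hw := delta_le_ww (θ := θ) hδ h
  set a : ℝ := inner ℝ ξ θ
  set w := ww ξ θ
  set sp := lam * rr ξ θ
  set sm := lam * rr ξ (-θ)
  set f := sp ^ 2 * R (sp • θ)
  set f' := sm ^ 2 * R (sm • (-θ))
  set q := sm ^ 2 * R (sm • θ)
  set Q := (lam * δ)⁻¹ ^ 2
  have hQ : 0 ≤ Q := by positivity
  have hip0 : 0 ≤ sp⁻¹ ^ 2 := by positivity
  have hT1 : (f - f') * a ≤ (3 / 2 * (η * Q)) * ‖ξ‖ := by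
    have : f - f' ≤ 3 / 2 * (η * Q) := by nlinarith
    calc (f - f') * a ≤ (3 / 2 * (η * Q)) * a := by gcongr
      _ ≤ _ := by gcongr
  have hw0 : 0 < w := by linarith
  have hT2 : (f + f') * ((a ^ 2 - ‖ξ‖ ^ 2) / w) ≤ (η * Q) * (‖ξ‖ * (1 / δ)) := by
    have hs : -(η * Q) ≤ f + f' := by nlinarith
    have hx0 := norm_nonneg ξ
    have hd : 0 ≤ (‖ξ‖ ^ 2 - a ^ 2) / w := by
      apply div_nonneg _ hw0.le
      nlinarith
    have hd2 : (‖ξ‖ ^ 2 - a ^ 2) / w ≤ ‖ξ‖ * (1 / δ) := by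
      rw [mul_one_div]
      apply div_le_div₀ hx0 _ hδ hw
      nlinarith
    calc (f + f') * ((a ^ 2 - ‖ξ‖ ^ 2) / w) = -(f + f') * ((‖ξ‖ ^ 2 - a ^ 2) / w) := by ring
      _ ≤ (η * Q) * ((‖ξ‖ ^ 2 - a ^ 2) / w) := by gcongr; linarith
      _ ≤ _ := by gcongr
  have e : f * (a + (a ^ 2 - ‖ξ‖ ^ 2) / w) + f' * (-a + ((-a) ^ 2 - ‖ξ‖ ^ 2) / w)
      = (f - f') * a + (f + f') * ((a ^ 2 - ‖ξ‖ ^ 2) / w) := by ring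
  rw [e]
  calc _ ≤ _ := add_le_add hT1 hT2
    _ = _ := by ring

end Helpers

theorem stmt2 (δ : ℝ) (hδ₀ : 0 < δ) (hδ₁ : δ < 1 / 2) (R : E3 → ℝ) (c : ℝ) (hc : 0 < c)
    (hR : ContDiffOn ℝ 1 R {x : E3 | 1 < ‖x‖})
    (hRbound : ∀ x : E3, 1 < ‖x‖ → |R x| ≤ c * ‖x‖⁻¹ ^ 4)
    (hDRbound : ∀ x : E3, 1 < ‖x‖ → ‖fderiv ℝ R x‖ ≤ c * ‖x‖⁻¹ ^ 5)
    (hasym : ∀ ε > (0 : ℝ), ∃ ρ > (1 : ℝ), ∀ x : E3, ρ ≤ ‖x‖ →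
      (∑ i : Fin 3,
          x i * fderiv ℝ (fun y : E3 => ‖y‖ ^ 2 * R y) x (EuclideanSpace.single i 1)
            ≤ ε * ‖x‖⁻¹ ^ 2) ∧
        |R x - R (-x)| ≤ ε * ‖x‖⁻¹ ^ 4) :
    ∀ ε > (0 : ℝ), ∃ lam₀ : ℝ, ∀ lam : ℝ, lam₀ ≤ lam → ∀ ξ : E3,
      0 < ‖ξ‖ → ‖ξ‖ < 1 - δ →
      DifferentiableAt ℝ (G2 R lam) ξ ∧
        ‖ξ‖⁻¹ * fderiv ℝ (G2 R lam) ξ ξ ≥ -ε := by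
  intro ε hε
  set σ : Measure (sphere (0 : E3) 1) := (volume : Measure E3).toSphere with hσ
  set M : ℝ := σ.real Set.univ with hM
  have hM0 : 0 ≤ M := measureReal_nonneg
  set K : ℝ := δ⁻¹ ^ 2 * (3 / 2 + 1 / δ) with hK
  have hK0 : 0 < K := by positivity
  set η : ℝ := ε / (K * M + 1) with hη
  have hη0 : 0 < η := by positivity
  have hηK : η * K * M ≤ ε := by
    rw [hη, div_mul_eq_mul_div, div_mul_eq_mul_div, div_le_iff₀ (by positivity)]
    nlinarith
  obtain ⟨ρ, hρ, hρ'⟩ := hasym η hη0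
  refine ⟨ρ / δ, fun lam hlam ξ hξ0 hξ => ?_⟩
  have h1 : ρ ≤ lam * δ := by rwa [div_le_iff₀ hδ₀] at hlam
  have hl : 0 < lam := (div_pos (by linarith) hδ₀).trans_le hlam
  have hlt : 1 < lam * δ := by linarith
  have hcont := hR.continuousOn
  have hG := G2_deriv hcont hc hRbound hδ₀ hl hlt hξ
  refine ⟨hG.differentiableAt, ?_⟩
  rw [hG.fderiv]
  have hHc := HD_cont hcont hδ₀ hl hlt hξ
  have hHi : Integrable (fun θ : S2 => HD R lam ξ θ) σ :=
    hHc.integrable_of_hasCompactSupport (HasCompactSupport.of_compactSpace _)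
  rw [ContinuousLinearMap.smul_apply, ContinuousLinearMap.integral_apply hHi]
  set u : S2 → ℝ := fun θ => HD R lam ξ θ ξ with hu
  have hui : Integrable u σ := hHi.apply_continuousLinearMap ξ
  have hneg : ∫ θ, u (-θ) ∂σ = ∫ θ, u θ ∂σ :=
    sphere_neg_mp.integral_comp (Homeomorph.neg S2).measurableEmbedding u
  have huni : Integrable (fun θ => u (-θ)) σ := sphere_neg_mp.integrable_comp_of_integrable hui
  have hpt : ∀ θ : S2, -(lam * (‖ξ‖ * (η * (lam * δ)⁻¹ ^ 2 * (3 / 2 + 1 / δ)))) ≤ u θ + u (-θ) := by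
    intro θ
    have hθ : ‖(θ:E3)‖ = 1 := by simp
    have := pointwise hη0 hR hρ hRbound hρ' hδ₀ hl h1 hξ hθ
    have := mul_le_mul_of_nonneg_left this hl.le
    simp only [hu, HD, ContinuousLinearMap.smul_apply, smul_eq_mul]
    have e : ((-θ : S2) : E3) = -(θ : E3) := rfl
    rw [e]
    linarith
  have hint := integral_mono (integrable_const _) (hui.add huni) hpt
  simp only [Pi.add_apply] at hint
  rw [integral_add hui huni, hneg, integral_const, smul_eq_mul, ← hM] at hint
  have hxi : 0 < ‖ξ‖⁻¹ := by positivity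
  have hfin : ‖ξ‖⁻¹ * lam * (M * -(lam * (‖ξ‖ * (η * (lam * δ)⁻¹ ^ 2 * (3 / 2 + 1 / δ)))))
      = -(η * K * M) := by
    rw [hK]; field_simp
  have h2 := mul_le_mul_of_nonneg_left hint (by positivity : 0 ≤ ‖ξ‖⁻¹ * lam)
  rw [hfin] at h2
  have h3 : ‖ξ‖⁻¹ * (2 * lam * ∫ θ, u θ ∂σ) = ‖ξ‖⁻¹ * lam * (∫ θ, u θ ∂σ + ∫ θ, u θ ∂σ) := by ring
  show ‖ξ‖⁻¹ * (2 * lam * ∫ θ, u θ ∂σ) ≥ -ε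
  rw [h3]
  linarith
end

section
/- The function G₁ is continuous on the open unit ball {ξ ∈ ℝ³ : |ξ| < 1}, satisfies G₁(0) = 0, is strictly convex on the open unit ball, and for every unit vector ω ∈ ℝ³ the map s ↦ G₁(sω) is strictly increasing on [0, 1). -/
open Metric Real

open Classical in
/-- The function `G₁` on the open unit ball of `ℝ³`. -/
noncomputable def G1 (ξ : E3) : ℝ :=
  if ξ = 0 then 0
  else 64 * π + 32 * π / (1 - ‖ξ‖ ^ 2) -
    48 * π * ‖ξ‖⁻¹ * Real.log ((1 + ‖ξ‖) / (1 - ‖ξ‖)) -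
    128 * π * Real.log (1 - ‖ξ‖ ^ 2)


lemma G1_hasSum (ξ : E3) (h : ‖ξ‖ < 1) :
    HasSum (fun k : ℕ => π * (32 - 96 / (2 * (k : ℝ) + 3) + 128 / ((k : ℝ) + 1)) *
      (‖ξ‖ ^ 2) ^ (k + 1)) (G1 ξ) := by
  by_cases h0 : ξ = 0
  · subst h0
    simp [G1, hasSum_zero]
  have hr : 0 < ‖ξ‖ := norm_pos_iff.mpr h0
  rw [G1, if_neg h0]
  generalize ‖ξ‖ = r at *
  have hu : r ^ 2 < 1 := by nlinarith
  have h1 := (hasSum_nat_add_iff' 1).mpr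
    (Real.hasSum_log_sub_log_of_abs_lt_one (x := r) (by rw [abs_of_pos hr]; exact h))
  have h2 := Real.hasSum_pow_div_log_of_abs_lt_one (x := r ^ 2)
    (by rw [abs_of_pos (by positivity)]; exact hu)
  have h3 := (hasSum_nat_add_iff' 1).mpr (hasSum_geometric_of_lt_one (sq_nonneg r) hu)
  have h4 := ((h3.mul_left (32 * π)).sub (h1.mul_left (48 * π * r⁻¹))).add (h2.mul_left (128 * π))
  convert h4 using 1
  · rfl
  · funext k
    push_cast
    have : r ^ (2 * (k + 1) + 1) = r * (r ^ 2) ^ (k + 1) := by rw [← pow_mul]; ring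
    rw [this]
    have : (2 * (k : ℝ) + 3) ≠ 0 := by positivity
    have h5 : (2 * ((k : ℝ) + 1) + 1) ≠ 0 := by positivity
    have h6 : (2 * ((k : ℝ) + 1) + 1) = 2 * k + 3 := by ring
    rw [h6]
    field_simp
    ring
  · rw [Real.log_div (by linarith) (by linarith)]
    have : 1 - r ^ 2 ≠ 0 := by linarith
    simp
    field_simp
    ring

lemma G1_coeff_pos (k : ℕ) :
    0 < π * (32 - 96 / (2 * (k : ℝ) + 3) + 128 / ((k : ℝ) + 1)) := by
  have h1 : 96 / (2 * (k : ℝ) + 3) ≤ 32 := by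
    rw [div_le_iff₀ (by positivity)]
    nlinarith [(Nat.cast_nonneg k : (0 : ℝ) ≤ k)]
  have h2 : 0 < 128 / ((k : ℝ) + 1) := by positivity
  have := Real.pi_pos
  apply mul_pos this
  linarith

lemma G1_strictConvex : StrictConvexOn ℝ (ball (0 : E3) 1) G1 := by
  refine ⟨convex_ball _ _, ?_⟩
  intro x hx y hy hxy a b ha hb hab
  have hz := convex_ball (0 : E3) 1 hx hy ha.le hb.le hab
  rw [mem_ball_zero_iff] at hx hy hz
  have key : ∀ k : ℕ, (‖a • x + b • y‖ ^ 2) ^ (k + 1) <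
      a * (‖x‖ ^ 2) ^ (k + 1) + b * (‖y‖ ^ 2) ^ (k + 1) := by
    intro k
    have e : ‖a • x + b • y‖ ^ 2 < a * ‖x‖ ^ 2 + b * ‖y‖ ^ 2 := by
      have h1 := norm_add_sq_real (a • x) (b • y)
      have h2 := norm_sub_sq_real x y
      have h3 : 0 < ‖x - y‖ ^ 2 := by
        have := norm_pos_iff.mpr (sub_ne_zero.mpr hxy)
        positivity
      rw [real_inner_smul_left, real_inner_smul_right, norm_smul, norm_smul, mul_pow, mul_pow,
        Real.norm_eq_abs, Real.norm_eq_abs, sq_abs, sq_abs] at h1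
      have h4 : 0 < a * b * ‖x - y‖ ^ 2 := by positivity
      rw [h2] at h4
      rw [h1]
      obtain rfl : b = 1 - a := by linarith
      nlinarith
    calc _ < (a * ‖x‖ ^ 2 + b * ‖y‖ ^ 2) ^ (k + 1) :=
          pow_lt_pow_left₀ e (by positivity) (by omega)
      _ ≤ _ := (convexOn_pow (k + 1)).2 (sq_nonneg ‖x‖) (sq_nonneg ‖y‖) ha.le hb.le hab
  have hs := ((G1_hasSum x hx).mul_left a).add ((G1_hasSum y hy).mul_left b)
  have hlt : ∀ k : ℕ, π * (32 - 96 / (2 * (k : ℝ) + 3) + 128 / ((k : ℝ) + 1)) *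
      (‖a • x + b • y‖ ^ 2) ^ (k + 1) <
      a * (π * (32 - 96 / (2 * (k : ℝ) + 3) + 128 / ((k : ℝ) + 1)) * (‖x‖ ^ 2) ^ (k + 1)) +
      b * (π * (32 - 96 / (2 * (k : ℝ) + 3) + 128 / ((k : ℝ) + 1)) * (‖y‖ ^ 2) ^ (k + 1)) := by
    intro k
    have := mul_lt_mul_of_pos_left (key k) (G1_coeff_pos k)
    linarith
  exact hasSum_lt (fun k => (hlt k).le) (hlt 0) (G1_hasSum _ hz) hs

theorem stmt4 :
    ContinuousOn G1 (ball (0 : E3) 1) ∧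
      G1 0 = 0 ∧
      StrictConvexOn ℝ (ball (0 : E3) 1) G1 ∧
      ∀ ω : E3, ‖ω‖ = 1 → StrictMonoOn (fun s : ℝ => G1 (s • ω)) (Set.Ico (0 : ℝ) 1) := by
  refine ⟨G1_strictConvex.convexOn.continuousOn isOpen_ball, by simp [G1], G1_strictConvex, ?_⟩
  intro ω hω s hs t ht hst
  have ns : ‖s • ω‖ = s := by rw [norm_smul, hω, mul_one, Real.norm_of_nonneg hs.1]
  have nt : ‖t • ω‖ = t := by rw [norm_smul, hω, mul_one, Real.norm_of_nonneg ht.1]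
  have h1 := G1_hasSum (s • ω) (by rw [ns]; exact hs.2)
  have h2 := G1_hasSum (t • ω) (by rw [nt]; exact ht.2)
  rw [ns] at h1
  rw [nt] at h2
  have hlt : ∀ k : ℕ, π * (32 - 96 / (2 * (k : ℝ) + 3) + 128 / ((k : ℝ) + 1)) *
      (s ^ 2) ^ (k + 1) <
      π * (32 - 96 / (2 * (k : ℝ) + 3) + 128 / ((k : ℝ) + 1)) * (t ^ 2) ^ (k + 1) := by
    intro k
    refine mul_lt_mul_of_pos_left ?_ (G1_coeff_pos k)
    exact pow_lt_pow_left₀ (pow_lt_pow_left₀ hst hs.1 (by norm_num)) (sq_nonneg s) (by omega)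
  exact hasSum_lt (fun k => (hlt k).le) (hlt 0) h1 h2
end

section
/- For every ξ ∈ ℝ³ with 0 < |ξ| < 3/4 one has ⟨∇G₁(ξ), ξ⟩ ≥ 256π |ξ|². -/
open Metric Real

theorem aux_log (r : ℝ) (h0 : 0 < r) (h1 : r < 1) :
    2 * r + 2 * r ^ 3 / 3 ≤ Real.log ((1 + r) / (1 - r)) := by
  have h := Real.hasSum_log_sub_log_of_abs_lt_one (x := r) (by rw [abs_of_pos h0]; exact h1)
  rw [Real.log_div (by linarith) (by linarith)]
  have h2 := sum_le_hasSum (Finset.range 2) (fun i _ => by positivity) h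
  simp only [Finset.sum_range_succ, Finset.sum_range_zero] at h2
  norm_num at h2
  linarith

theorem aux_deriv (r : ℝ) (h0 : 0 < r) (h1 : r < 1) :
    HasDerivAt (fun r : ℝ => 64 * π + 32 * π / (1 - r ^ 2) -
      48 * π * r⁻¹ * Real.log ((1 + r) / (1 - r)) - 128 * π * Real.log (1 - r ^ 2))
      (64 * π * r / (1 - r ^ 2) ^ 2 + 48 * π * Real.log ((1 + r) / (1 - r)) / r ^ 2
        - 96 * π / (r * (1 - r ^ 2)) + 256 * π * r / (1 - r ^ 2)) r := by
  have hs : 1 - r ^ 2 ≠ 0 := by nlinarith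
  have hm : 1 - r ≠ 0 := by linarith
  have hp : 1 + r ≠ 0 := by linarith
  have hr : r ≠ 0 := h0.ne'
  have d1 : HasDerivAt (fun r : ℝ => 1 - r ^ 2) (-(2 * r)) r := by
    simpa using (hasDerivAt_pow 2 r).const_sub 1
  have d2 : HasDerivAt (fun r : ℝ => (1 + r) / (1 - r))
      ((1 * (1 - r) - (1 + r) * (-1)) / (1 - r) ^ 2) r :=
    ((hasDerivAt_id r).const_add 1).div ((hasDerivAt_id r).const_sub 1) hm
  have d3 := d2.log (div_ne_zero hp hm)
  have d4 := (((((hasDerivAt_const r (32 * π)).div d1 hs).const_add (64 * π)).sub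
    (((hasDerivAt_inv hr).const_mul (48 * π)).mul d3)).sub ((d1.log hs).const_mul (128 * π)))
  refine d4.congr_deriv ?_
  generalize Real.log ((1 + r) / (1 - r)) = L
  have e : 1 - r ^ 2 = (1 - r) * (1 + r) := by ring
  rw [e]
  field_simp
  ring

theorem stmt5 (ξ : E3) (h₀ : 0 < ‖ξ‖) (h₁ : ‖ξ‖ < 3 / 4) :
    fderiv ℝ G1 ξ ξ ≥ 256 * π * ‖ξ‖ ^ 2 := by
  have hξ : ξ ≠ 0 := norm_pos_iff.mp h₀
  have hd : DifferentiableAt ℝ (fun x : E3 => ‖x‖) ξ := differentiableAt_id.norm ℝ hξ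
  have hn := hd.hasFDerivAt
  have hc := (aux_deriv ‖ξ‖ h₀ (by linarith)).comp_hasFDerivAt ξ hn
  have he : G1 =ᶠ[nhds ξ] ((fun r : ℝ => 64 * π + 32 * π / (1 - r ^ 2) -
      48 * π * r⁻¹ * Real.log ((1 + r) / (1 - r)) - 128 * π * Real.log (1 - r ^ 2)) ∘
      fun x : E3 => ‖x‖) := by
    filter_upwards [isOpen_ne.mem_nhds hξ] with x hx
    have hx' : x ≠ 0 := hx
    simp [G1, hx']
  rw [(hc.congr_of_eventuallyEq he).fderiv]
  have hself : fderiv ℝ (fun x : E3 => ‖x‖) ξ ξ = ‖ξ‖ := hd.fderiv_norm_self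
  rw [ContinuousLinearMap.smul_apply, hself, smul_eq_mul]
  have hl := aux_log ‖ξ‖ h₀ (by linarith)
  generalize ‖ξ‖ = r at *
  generalize Real.log ((1 + r) / (1 - r)) = L at *
  have hs : 0 < 1 - r ^ 2 := by nlinarith
  have hL : 2 + 2 * r ^ 2 / 3 ≤ L / r := by
    rw [le_div_iff₀ h₀]; linarith
  have key : 256 * r ^ 2 ≤ 64 * r ^ 2 / (1 - r ^ 2) ^ 2 + 48 * (2 + 2 * r ^ 2 / 3)
      - 96 / (1 - r ^ 2) + 256 * r ^ 2 / (1 - r ^ 2) := by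
    have : 64 * r ^ 2 / (1 - r ^ 2) ^ 2 + 48 * (2 + 2 * r ^ 2 / 3)
      - 96 / (1 - r ^ 2) + 256 * r ^ 2 / (1 - r ^ 2) - 256 * r ^ 2
      = r ^ 4 * (64 * (2 - r ^ 2) / (1 - r ^ 2) ^ 2 + 160 / (1 - r ^ 2)) := by
      field_simp
      ring
    have h2 : 0 ≤ 2 - r ^ 2 := by linarith
    have : 0 ≤ r ^ 4 * (64 * (2 - r ^ 2) / (1 - r ^ 2) ^ 2 + 160 / (1 - r ^ 2)) := by
      positivity
    linarith
  have e : (64 * π * r / (1 - r ^ 2) ^ 2 + 48 * π * L / r ^ 2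
        - 96 * π / (r * (1 - r ^ 2)) + 256 * π * r / (1 - r ^ 2)) * r
      = π * (64 * r ^ 2 / (1 - r ^ 2) ^ 2 + 48 * (L / r)
      - 96 / (1 - r ^ 2) + 256 * r ^ 2 / (1 - r ^ 2)) := by
    field_simp
  rw [e]
  have := mul_le_mul_of_nonneg_left (key.trans (b := _) (c := 64 * r ^ 2 / (1 - r ^ 2) ^ 2
    + 48 * (L / r) - 96 / (1 - r ^ 2) + 256 * r ^ 2 / (1 - r ^ 2)) (by linarith)) Real.pi_pos.le
  linarith
end

section
/- Let λ > 0, ℓ ∈ {1, 2, 3}, and let σ be a C¹ symmetric 2-tensor on an open neighborhood of the sphere S_λ(0) in ℝ³. Then ∫_{S_λ(0)} [ ∑_{i,j=1}^{3} x^ℓ x^j (∂ᵢσᵢⱼ − ∂ⱼσᵢᵢ) − ∑_{i=1}^{3} (xⁱ σᵢℓ − x^ℓ σᵢᵢ) ] dμ̄ = λ² ∫_{S_λ(0)} [ ∑_{i,j=1}^{3} ν̄ᵢ ν̄ⱼ ∂_ℓ σᵢⱼ − ∂_ℓ(tr σ) + 2 λ⁻¹ ν̄^ℓ tr σ ] dμ̄.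 -/
open MeasureTheory Metric

/-- The Euclidean surface integral of `f` over the sphere of radius `lam` centered at `c`. -/
noncomputable def sphereIntegral (lam : ℝ) (c : E3) (f : E3 → ℝ) : ℝ :=
  lam ^ 2 * ∫ y : sphere (0 : E3) 1, f (c + lam • (y : E3)) ∂(volume : Measure E3).toSphere

/-- The partial derivative `∂ₖ σᵢⱼ` of a matrix-valued field at `x`. -/
noncomputable def pd (σ : E3 → Matrix (Fin 3) (Fin 3) ℝ) (k i j : Fin 3) (x : E3) : ℝ :=
  fderiv ℝ (fun y => σ y i j) x (EuclideanSpace.single k 1)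

/-- Infinitesimal rotation. -/
noncomputable def rotGen (a b : Fin 3) (x : E3) : E3 :=
  x a • EuclideanSpace.single b (1 : ℝ) - x b • EuclideanSpace.single a (1 : ℝ)

/-- Rotation by angle `t` in the `a b` plane. -/
noncomputable def rotLin (a b : Fin 3) (t : ℝ) : E3 →ₗ[ℝ] E3 where
  toFun x := x + (Real.cos t - 1) • (x a • EuclideanSpace.single a (1 : ℝ) +
    x b • EuclideanSpace.single b (1 : ℝ)) + Real.sin t • rotGen a b x
  map_add' x y := by
    simp only [rotGen, PiLp.add_apply]; module
  map_smul' c x := by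
    simp only [rotGen, PiLp.smul_apply, smul_eq_mul, RingHom.id_apply]; module

lemma rotLin_apply (a b : Fin 3) (t : ℝ) (x : E3) : rotLin a b t x =
    x + (Real.cos t - 1) • (x a • EuclideanSpace.single a (1 : ℝ) +
    x b • EuclideanSpace.single b (1 : ℝ)) + Real.sin t • rotGen a b x := rfl

lemma rotLin_norm (a b : Fin 3) (hab : a ≠ b) (t : ℝ) (x : E3) : ‖rotLin a b t x‖ = ‖x‖ := by
  rw [EuclideanSpace.norm_eq, EuclideanSpace.norm_eq]
  congr 1
  have h := Real.sin_sq_add_cos_sq t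
  have h' : Real.cos t ^ 2 = 1 - Real.sin t ^ 2 := by linarith
  simp only [rotLin_apply, rotGen, Fin.sum_univ_three, Real.norm_eq_abs, sq_abs]
  fin_cases a <;> fin_cases b <;> simp at hab ⊢ <;> ring_nf <;> rw [h'] <;> ring

noncomputable def rotIso (a b : Fin 3) (hab : a ≠ b) (t : ℝ) : E3 ≃ₗᵢ[ℝ] E3 :=
  LinearIsometry.toLinearIsometryEquiv ⟨rotLin a b t, rotLin_norm a b hab t⟩ rfl

lemma rotIso_apply (a b : Fin 3) (hab : a ≠ b) (t : ℝ) (x : E3) :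
    rotIso a b hab t x = rotLin a b t x := rfl

lemma rot_deriv (a b : Fin 3) (hab : a ≠ b) (t : ℝ) (x : E3) :
    HasDerivAt (fun s => rotLin a b s x) (rotGen a b (rotLin a b t x)) t := by
  have h : HasDerivAt (fun s => rotLin a b s x)
      ((- Real.sin t) • (x a • EuclideanSpace.single a (1 : ℝ) +
      x b • EuclideanSpace.single b (1 : ℝ)) + Real.cos t • rotGen a b x) t := by
    simp only [rotLin_apply]
    refine HasDerivAt.add (HasDerivAt.const_add _ ?_) ?_
    · exact HasDerivAt.smul_const ((Real.hasDerivAt_cos t).sub_const 1) _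
    · exact HasDerivAt.smul_const (Real.hasDerivAt_sin t) _
  convert h using 1
  have hba : b ≠ a := hab.symm
  simp only [rotLin_apply, rotGen, PiLp.add_apply, PiLp.sub_apply, PiLp.smul_apply, smul_eq_mul,
    PiLp.single_apply, hab, hba, if_true, if_false]
  module

open scoped Pointwise in
/-- Invariance of the sphere measure under isometries. -/
lemma toSphere_invariant (A : E3 ≃ₗᵢ[ℝ] E3) (h : E3 → ℝ) :
    ∫ y : sphere (0 : E3) 1, h (A y) ∂(volume : Measure E3).toSphere =
    ∫ y : sphere (0 : E3) 1, h y ∂(volume : Measure E3).toSphere := by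
  have hm : ∀ (A : E3 ≃ₗᵢ[ℝ] E3) (y : sphere (0 : E3) 1), A y ∈ sphere (0 : E3) 1 := by
    intro A y
    have := y.2
    simpa using this
  let e : sphere (0 : E3) 1 ≃ₜ sphere (0 : E3) 1 :=
    { toFun := fun y => ⟨A y, hm A y⟩
      invFun := fun y => ⟨A.symm y, hm A.symm y⟩
      left_inv := fun y => by simp
      right_inv := fun y => by simp
      continuous_toFun := by fun_prop
      continuous_invFun := by fun_prop }
  have hp : MeasurePreserving e (volume : Measure E3).toSphere (volume : Measure E3).toSphere := by
    refine ⟨e.continuous.measurable, ?_⟩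
    ext s hs
    rw [Measure.map_apply e.continuous.measurable hs,
      Measure.toSphere_apply' _ (e.continuous.measurable hs), Measure.toSphere_apply' _ hs]
    congr 1
    have hset : Set.Ioo (0 : ℝ) 1 • ((↑) '' (e ⁻¹' s) : Set E3) =
        A ⁻¹' (Set.Ioo (0 : ℝ) 1 • ((↑) '' s : Set E3)) := by
      ext x
      simp only [Set.mem_smul, Set.mem_preimage, Set.mem_image]
      constructor
      · rintro ⟨r, hr, _, ⟨y, hy, rfl⟩, rfl⟩
        exact ⟨r, hr, _, ⟨e y, hy, rfl⟩, by simp [e]⟩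
      · rintro ⟨r, hr, _, ⟨y, hy, rfl⟩, hx⟩
        refine ⟨r, hr, _, ⟨e.symm y, by simpa using hy, rfl⟩, ?_⟩
        apply A.injective
        rw [← hx]
        simp [e]
    rw [hset]
    exact A.measurePreserving.measure_preimage_equiv (f := A.toMeasurableEquiv) _
  exact hp.integral_comp e.measurableEmbedding (fun y => h y)

lemma smul_mem_sphere' {lam : ℝ} (hlam : 0 < lam) (y : sphere (0 : E3) 1) :
    lam • (y : E3) ∈ sphere (0 : E3) lam := by
  simp [norm_smul, abs_of_pos hlam]

lemma key (lam : ℝ) (hlam : 0 < lam) (U : Set E3) (hU : IsOpen U)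
    (hUS : sphere (0 : E3) lam ⊆ U) (g : E3 → ℝ) (hg : ContDiffOn ℝ 1 g U) (a b : Fin 3) :
    Integrable (fun y : sphere (0 : E3) 1 => fderiv ℝ g (lam • (y : E3))
      (rotGen a b (lam • (y : E3)))) (volume : Measure E3).toSphere ∧
    ∫ y : sphere (0 : E3) 1, fderiv ℝ g (lam • (y : E3))
      (rotGen a b (lam • (y : E3))) ∂(volume : Measure E3).toSphere = 0 := by
  by_cases hab : a = b
  · subst hab
    simp [rotGen]
  have hD : ContinuousOn (fun x => fderiv ℝ g x (rotGen a b x)) (sphere (0 : E3) lam) := by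
    have h1 := (hg.continuousOn_fderiv_of_isOpen hU le_rfl).mono hUS
    refine h1.clm_apply ?_
    unfold rotGen
    fun_prop
  obtain ⟨C, hC⟩ := (isCompact_sphere (0 : E3) lam).exists_bound_of_continuousOn hD
  have hmem : ∀ (t : ℝ) (y : sphere (0 : E3) 1),
      rotLin a b t (lam • (y : E3)) ∈ sphere (0 : E3) lam := by
    intro t y
    have := smul_mem_sphere' hlam y
    rw [mem_sphere_zero_iff_norm] at this ⊢
    rw [rotLin_norm a b hab, this]
  have hcont : ∀ t : ℝ, Continuous (fun y : sphere (0 : E3) 1 => rotLin a b t (lam • (y : E3))) := by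
    intro t
    exact (rotIso a b hab t).continuous.comp (by fun_prop)
  have hF : ∀ t : ℝ, Continuous (fun y : sphere (0 : E3) 1 => g (rotLin a b t (lam • (y : E3)))) :=
    fun t => (hg.continuousOn.mono hUS).comp_continuous (hcont t) (hmem t)
  have hF' : ∀ t : ℝ, Continuous (fun y : sphere (0 : E3) 1 =>
      fderiv ℝ g (rotLin a b t (lam • (y : E3))) (rotGen a b (rotLin a b t (lam • (y : E3))))) :=
    fun t => hD.comp_continuous (hcont t) (hmem t)
  have main := hasDerivAt_integral_of_dominated_loc_of_deriv_le
    (μ := (volume : Measure E3).toSphere) (s := Set.univ) (x₀ := (0 : ℝ))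
    (F := fun t (y : sphere (0 : E3) 1) => g (rotLin a b t (lam • (y : E3))))
    (F' := fun t (y : sphere (0 : E3) 1) =>
      fderiv ℝ g (rotLin a b t (lam • (y : E3))) (rotGen a b (rotLin a b t (lam • (y : E3)))))
    (bound := fun _ => C) Filter.univ_mem
    (Filter.Eventually.of_forall fun t => (hF t).aestronglyMeasurable)
    ((hF 0).integrable_of_hasCompactSupport (HasCompactSupport.of_compactSpace _))
    (hF' 0).aestronglyMeasurable
    (Filter.Eventually.of_forall fun y t _ => hC _ (hmem t y))
    (integrable_const C)
    (Filter.Eventually.of_forall fun y t _ => by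
      have hd : DifferentiableAt ℝ g (rotLin a b t (lam • (y : E3))) :=
        (hg.contDiffAt (hU.mem_nhds (hUS (hmem t y)))).differentiableAt (by norm_num)
      exact hd.hasFDerivAt.comp_hasDerivAt t (rot_deriv a b hab t _))
  have h0 : ∀ x : E3, rotLin a b 0 x = x := by intro x; simp [rotLin_apply]
  simp only [h0] at main
  refine ⟨main.1, ?_⟩
  have hconst : (fun t : ℝ => ∫ y : sphere (0 : E3) 1, g (rotLin a b t (lam • (y : E3)))
      ∂(volume : Measure E3).toSphere) = fun _ => ∫ y : sphere (0 : E3) 1, g (lam • (y : E3))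
      ∂(volume : Measure E3).toSphere := by
    funext t
    rw [← toSphere_invariant (rotIso a b hab t) (fun x => g (lam • x))]
    simp only [rotIso_apply, map_smul]
  rw [hconst] at main
  exact main.2.unique (hasDerivAt_const _ _)

/-- The vector field component used in the integration by parts. -/
noncomputable def gfun (σ : E3 → Matrix (Fin 3) (Fin 3) ℝ) (i : Fin 3) (x : E3) : ℝ :=
  (∑ j : Fin 3, x j * σ x i j) - x i * ∑ j : Fin 3, σ x j j

lemma coord_hasFDerivAt (j : Fin 3) (x : E3) :
    HasFDerivAt (fun y : E3 => y j) (EuclideanSpace.proj j : E3 →L[ℝ] ℝ) x :=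
  (EuclideanSpace.proj j : E3 →L[ℝ] ℝ).hasFDerivAt

lemma gfun_fderiv (σ : E3 → Matrix (Fin 3) (Fin 3) ℝ) (x : E3)
    (hσ : ∀ i j, DifferentiableAt ℝ (fun y => σ y i j) x) (i k : Fin 3) :
    fderiv ℝ (gfun σ i) x (EuclideanSpace.single k 1) =
      (∑ j : Fin 3, (x j * pd σ k i j x + (if j = k then 1 else 0) * σ x i j)) -
      (x i * (∑ j : Fin 3, pd σ k j j x) + (if i = k then 1 else 0) * ∑ j : Fin 3, σ x j j) := by
  have h : HasFDerivAt (gfun σ i) _ x :=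
    (HasFDerivAt.fun_sum (u := Finset.univ) fun j _ =>
      (coord_hasFDerivAt j x).mul (hσ i j).hasFDerivAt).sub
    ((coord_hasFDerivAt i x).mul
      (HasFDerivAt.fun_sum (u := Finset.univ) fun j _ => (hσ j j).hasFDerivAt))
  rw [h.fderiv]
  simp [pd, Fin.sum_univ_three, PiLp.single_apply]
  ring

theorem stmt11 (lam : ℝ) (hlam : 0 < lam) (ℓ : Fin 3)
    (σ : E3 → Matrix (Fin 3) (Fin 3) ℝ)
    (hsym : ∀ x i j, σ x i j = σ x j i)
    (U : Set E3) (hU : IsOpen U) (hUS : sphere (0 : E3) lam ⊆ U)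
    (hσ : ∀ i j, ContDiffOn ℝ 1 (fun y => σ y i j) U) :
    sphereIntegral lam 0
        (fun x =>
          (∑ i : Fin 3, ∑ j : Fin 3, x ℓ * x j * (pd σ i i j x - pd σ j i i x)) -
            ∑ i : Fin 3, (x i * σ x i ℓ - x ℓ * σ x i i)) =
      lam ^ 2 *
        sphereIntegral lam 0
          (fun x =>
            (∑ i : Fin 3, ∑ j : Fin 3, (lam⁻¹ * x i) * (lam⁻¹ * x j) * pd σ ℓ i j x) -
              (∑ i : Fin 3, pd σ ℓ i i x) +
              2 * lam⁻¹ * (lam⁻¹ * x ℓ) * ∑ i : Fin 3, σ x i i) := by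
  have hg : ∀ i, ContDiffOn ℝ 1 (gfun σ i) U := by
    intro i
    have hc : ∀ j : Fin 3, ContDiffOn ℝ 1 (fun y : E3 => y j) U := fun j =>
      (EuclideanSpace.proj j : E3 →L[ℝ] ℝ).contDiff.contDiffOn
    exact (ContDiffOn.sum fun j _ => (hc j).mul (hσ i j)).sub
      ((hc i).mul (ContDiffOn.sum fun j _ => hσ j j))
  have hk := fun i => key lam hlam U hU hUS (gfun σ i) (hg i) ℓ i
  unfold sphereIntegral
  simp only [zero_add]
  rw [mul_left_comm]
  congr 1
  rw [← integral_const_mul]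
  set D : sphere (0 : E3) 1 → ℝ := fun y => ∑ i : Fin 3, fderiv ℝ (gfun σ i) (lam • (y : E3))
      (rotGen ℓ i (lam • (y : E3))) with hDdef
  have hDi : Integrable D (volume : Measure E3).toSphere :=
    integrable_finset_sum _ fun i _ => (hk i).1
  have hD0 : ∫ y, D y ∂(volume : Measure E3).toSphere = 0 := by
    rw [hDdef, integral_finset_sum _ fun i _ => (hk i).1]
    exact Finset.sum_eq_zero fun i _ => (hk i).2
  have gen : ∀ F G : sphere (0 : E3) 1 → ℝ, (∀ y, F y = G y + D y) →
      ∫ y, F y ∂(volume : Measure E3).toSphere = ∫ y, G y ∂(volume : Measure E3).toSphere := by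
    intro F G h
    have hF : F = fun y => G y + D y := funext h
    by_cases hG : Integrable G (volume : Measure E3).toSphere
    · rw [hF, integral_add hG hDi, hD0, add_zero]
    · rw [integral_undef hG, integral_undef]
      intro hFi
      apply hG
      have : G = F - D := by funext y; simp [h y]
      rw [this]
      exact hFi.sub hDi
  apply gen
  intro y
  have hx := smul_mem_sphere' hlam y
  rw [hDdef]
  dsimp only
  generalize lam • (y : E3) = x at hx ⊢
  have hd : ∀ i j, DifferentiableAt ℝ (fun y => σ y i j) x := fun i j =>
    ((hσ i j).contDiffAt (hU.mem_nhds (hUS hx))).differentiableAt (by norm_num)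
  have hn : x 0 ^ 2 + x 1 ^ 2 + x 2 ^ 2 = lam ^ 2 := by
    rw [mem_sphere_zero_iff_norm] at hx
    rw [← hx, EuclideanSpace.norm_sq_eq, Fin.sum_univ_three]
    simp
  have hl : lam * lam⁻¹ = 1 := mul_inv_cancel₀ hlam.ne'
  have hR : lam ^ 2 * ((∑ i : Fin 3, ∑ j : Fin 3, (lam⁻¹ * x i) * (lam⁻¹ * x j) * pd σ ℓ i j x) -
              (∑ i : Fin 3, pd σ ℓ i i x) +
              2 * lam⁻¹ * (lam⁻¹ * x ℓ) * ∑ i : Fin 3, σ x i i) =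
      (∑ i : Fin 3, ∑ j : Fin 3, x i * x j * pd σ ℓ i j x) -
        (x 0 ^ 2 + x 1 ^ 2 + x 2 ^ 2) * (∑ i : Fin 3, pd σ ℓ i i x) +
        2 * x ℓ * ∑ i : Fin 3, σ x i i := by
    rw [hn]
    simp only [Fin.sum_univ_three]
    field_simp
  have hs10 := hsym x 1 0
  have hs20 := hsym x 2 0
  have hs21 := hsym x 2 1
  rw [hR]
  simp only [rotGen, map_sub, map_smul, smul_eq_mul, gfun_fderiv σ x hd]
  simp only [Fin.sum_univ_three]
  fin_cases ℓ <;> simp [hs10, hs20, hs21] <;> ring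
end

section
/- Let σ be a C² symmetric 2-tensor on an open set U ⊂ ℝ³ with 0 ∉ U, let a ∈ ℝ³, set Y(x) = |x|⁻³ x, and define the vector field T on U by Tᵢ = (D_Y σ)(a, eᵢ) + (D_a σ)(Y, eᵢ) − (D_{eᵢ} σ)(Y, a) − Yᵢ (D_a tr σ). Then the Euclidean divergence of T satisfies, pointwise on U: div T = |x|⁻³ ∑_{i=1}^{3} [ (D²_{eᵢ,x}σ)(eᵢ, a) + (D²_{eᵢ,a}σ)(eᵢ, x) − (D²_{eᵢ,eᵢ}σ)(x, a) − (D²_{x,a}σ)(eᵢ, eᵢ) ] + |x|⁻³ [ (D_a tr σ) − 3|x|⁻² (D_a σ)(x, x) ]. -/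
/-- The second partial derivative `∂ₖ∂ₗ σᵢⱼ` of a matrix-valued field at `x`. -/
noncomputable def pd2 (σ : E3 → Matrix (Fin 3) (Fin 3) ℝ) (k l i j : Fin 3) (x : E3) : ℝ :=
  fderiv ℝ (fun y => pd σ l i j y) x (EuclideanSpace.single k 1)

/-- `(D_b σ)(X, Y) = ∑_{i,j,k} bₖ Xᵢ Yⱼ ∂ₖσᵢⱼ`. -/
noncomputable def Dsig (σ : E3 → Matrix (Fin 3) (Fin 3) ℝ) (b X Y : E3) (x : E3) : ℝ :=
  ∑ k : Fin 3, ∑ i : Fin 3, ∑ j : Fin 3, b k * X i * Y j * pd σ k i j x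

/-- `(D²_{b,c} σ)(X, Y) = ∑_{i,j,k,l} bₖ cₗ Xᵢ Yⱼ ∂ₖ∂ₗσᵢⱼ`. -/
noncomputable def D2sig (σ : E3 → Matrix (Fin 3) (Fin 3) ℝ) (b c X Y : E3) (x : E3) : ℝ :=
  ∑ k : Fin 3, ∑ l : Fin 3, ∑ i : Fin 3, ∑ j : Fin 3,
    b k * c l * X i * Y j * pd2 σ k l i j x

/-- `D_b tr σ = ∑ₖ bₖ ∂ₖ(tr σ)`. -/
noncomputable def DsigTr (σ : E3 → Matrix (Fin 3) (Fin 3) ℝ) (b : E3) (x : E3) : ℝ :=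
  ∑ k : Fin 3, b k * ∑ i : Fin 3, pd σ k i i x

/-- Directional derivative of the inverse cube of the norm. -/
theorem aux_norm (x : E3) (hx : x ≠ 0) (v : E3) :
    DifferentiableAt ℝ (fun y : E3 => (‖y‖ ^ 3)⁻¹) x ∧
    fderiv ℝ (fun y : E3 => (‖y‖ ^ 3)⁻¹) x v
      = -3 * (‖x‖ ^ 3)⁻¹ * (‖x‖ ^ 2)⁻¹ * inner ℝ x v := by
  have hn : ‖x‖ ≠ 0 := norm_ne_zero_iff.mpr hx
  have hd : DifferentiableAt ℝ (fun y : E3 => ‖y‖) x := differentiableAt_id.norm ℝ hx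
  have h1 := hd.hasFDerivAt
  have h2 := (hasStrictFDerivAt_norm_sq x).hasFDerivAt
  have h3 := congrArg (fun L : E3 →L[ℝ] ℝ => L v) ((h1.pow 2).unique h2)
  simp at h3
  have h4 : fderiv ℝ (fun y : E3 => ‖y‖) x v = ‖x‖⁻¹ * inner ℝ x v := by
    field_simp
    linarith
  have h5 := (hasDerivAt_inv (pow_ne_zero 3 hn)).comp_hasFDerivAt x (h1.pow 3)
  refine ⟨h5.differentiableAt, ?_⟩
  have h6 := h5.fderiv
  simp only [Function.comp_def] at h6
  rw [h6]
  simp [h4]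
  field_simp

theorem aux_Y (x : E3) (hx : x ≠ 0) (k : Fin 3) :
    DifferentiableAt ℝ (fun y : E3 => (‖y‖ ^ 3)⁻¹ * y k) x ∧
    ∀ i, fderiv ℝ (fun y : E3 => (‖y‖ ^ 3)⁻¹ * y k) x (EuclideanSpace.single i 1)
      = (‖x‖ ^ 3)⁻¹ * ((if k = i then 1 else 0) - 3 * (‖x‖ ^ 2)⁻¹ * x i * x k) := by
  have hN := (aux_norm x hx 0).1
  have hc : HasFDerivAt (fun y : E3 => y k) (EuclideanSpace.proj k : E3 →L[ℝ] ℝ) x :=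
    (EuclideanSpace.proj k : E3 →L[ℝ] ℝ).hasFDerivAt
  have h := hN.hasFDerivAt.mul hc
  refine ⟨h.differentiableAt, fun i => ?_⟩
  have h6 := h.fderiv
  simp only [Pi.mul_def] at h6
  rw [h6]
  simp only [ContinuousLinearMap.add_apply, ContinuousLinearMap.smul_apply, smul_eq_mul,
    (aux_norm x hx _).2]
  simp [EuclideanSpace.inner_single_right, Pi.single_apply]
  split_ifs <;> ring

theorem aux_pd (σ : E3 → Matrix (Fin 3) (Fin 3) ℝ)
    (U : Set E3) (hU : IsOpen U)
    (hσ : ∀ i j, ContDiffOn ℝ 2 (fun y => σ y i j) U) (x : E3) (hx : x ∈ U) (k i j : Fin 3) :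
    DifferentiableAt ℝ (pd σ k i j) x := by
  have h := (hσ i j).contDiffAt (hU.mem_nhds hx)
  have h1 : ContDiffAt ℝ 1 (fderiv ℝ (fun y => σ y i j)) x := h.fderiv_right (by norm_num)
  exact (h1.differentiableAt (by norm_num)).clm_apply (differentiableAt_const _)

theorem aux_Dsig (σ : E3 → Matrix (Fin 3) (Fin 3) ℝ) (x : E3) (b X Y : E3 → E3)
    (hb : ∀ k, DifferentiableAt ℝ (fun y => b y k) x)
    (hX : ∀ k, DifferentiableAt ℝ (fun y => X y k) x)
    (hY : ∀ k, DifferentiableAt ℝ (fun y => Y y k) x)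
    (hP : ∀ k i j, DifferentiableAt ℝ (pd σ k i j) x) :
    HasFDerivAt (fun y => Dsig σ (b y) (X y) (Y y) y)
      (∑ k : Fin 3, ∑ i : Fin 3, ∑ j : Fin 3,
        ((b x k * X x i * Y x j) • fderiv ℝ (pd σ k i j) x +
         pd σ k i j x • ((b x k * X x i) • fderiv ℝ (fun y => Y y j) x +
          Y x j • (b x k • fderiv ℝ (fun y => X y i) x + X x i • fderiv ℝ (fun y => b y k) x)))) x := by
  unfold Dsig
  refine HasFDerivAt.fun_sum fun k _ => HasFDerivAt.fun_sum fun i _ => HasFDerivAt.fun_sum fun j _ => ?_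
  exact (((hb k).hasFDerivAt.mul (hX i).hasFDerivAt).mul (hY j).hasFDerivAt).mul (hP k i j).hasFDerivAt

theorem aux_Tr (σ : E3 → Matrix (Fin 3) (Fin 3) ℝ) (x a : E3)
    (hP : ∀ k i j, DifferentiableAt ℝ (pd σ k i j) x) :
    HasFDerivAt (fun y => DsigTr σ a y)
      (∑ k : Fin 3, a k • ∑ i : Fin 3, fderiv ℝ (pd σ k i i) x) x := by
  unfold DsigTr
  exact HasFDerivAt.fun_sum fun k _ =>
    (HasFDerivAt.fun_sum fun i _ => (hP k i i).hasFDerivAt).const_mul (a k)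

set_option maxHeartbeats 4000000 in
theorem stmt13 (σ : E3 → Matrix (Fin 3) (Fin 3) ℝ)
    (hsym : ∀ x i j, σ x i j = σ x j i)
    (U : Set E3) (hU : IsOpen U) (h0 : (0 : E3) ∉ U)
    (hσ : ∀ i j, ContDiffOn ℝ 2 (fun y => σ y i j) U)
    (a : E3) :
    ∀ x ∈ U,
      (∑ i : Fin 3,
          fderiv ℝ
            (fun y : E3 =>
              Dsig σ ((‖y‖ ^ 3)⁻¹ • y) a (EuclideanSpace.single i 1) y +
                Dsig σ a ((‖y‖ ^ 3)⁻¹ • y) (EuclideanSpace.single i 1) y -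
                Dsig σ (EuclideanSpace.single i 1) ((‖y‖ ^ 3)⁻¹ • y) a y -
                ((‖y‖ ^ 3)⁻¹ * y i) * DsigTr σ a y)
            x (EuclideanSpace.single i 1)) =
        (‖x‖ ^ 3)⁻¹ *
            (∑ i : Fin 3,
              (D2sig σ (EuclideanSpace.single i 1) x (EuclideanSpace.single i 1) a x +
                D2sig σ (EuclideanSpace.single i 1) a (EuclideanSpace.single i 1) x x -
                D2sig σ (EuclideanSpace.single i 1) (EuclideanSpace.single i 1) x a x -
                D2sig σ x a (EuclideanSpace.single i 1) (EuclideanSpace.single i 1) x)) +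
          (‖x‖ ^ 3)⁻¹ * (DsigTr σ a x - 3 * (‖x‖ ^ 2)⁻¹ * Dsig σ a x x x) := by
  intro x hx
  have hx0 : x ≠ 0 := fun h => h0 (h ▸ hx)
  have hP := aux_pd σ U hU hσ x hx
  have hsP : ∀ k i j, pd σ k i j = pd σ k j i := by
    intro k i j
    funext y
    unfold pd
    simp only [hsym _ i j]
  have hYd : ∀ k, DifferentiableAt ℝ (fun y : E3 => ((‖y‖ ^ 3)⁻¹ • y) k) x :=
    fun k => (aux_Y x hx0 k).1
  have hYf : ∀ k i, fderiv ℝ (fun y : E3 => ((‖y‖ ^ 3)⁻¹ • y) k) x (EuclideanSpace.single i 1)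
      = (‖x‖ ^ 3)⁻¹ * ((if k = i then 1 else 0) - 3 * (‖x‖ ^ 2)⁻¹ * x i * x k) :=
    fun k => (aux_Y x hx0 k).2
  have hc : ∀ (c : E3) k, DifferentiableAt ℝ (fun _ : E3 => c k) x :=
    fun c k => differentiableAt_const _
  have hT : ∀ i : Fin 3, _ := fun i : Fin 3 =>
    ((((aux_Dsig σ x (fun y => (‖y‖ ^ 3)⁻¹ • y) (fun _ => a)
      (fun _ => EuclideanSpace.single i 1) hYd (hc _) (hc _) hP).add
      (aux_Dsig σ x (fun _ => a) (fun y => (‖y‖ ^ 3)⁻¹ • y)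
      (fun _ => EuclideanSpace.single i 1) (hc _) hYd (hc _) hP)).sub
      (aux_Dsig σ x (fun _ => EuclideanSpace.single i 1) (fun y => (‖y‖ ^ 3)⁻¹ • y)
      (fun _ => a) (hc _) hYd (hc _) hP)).sub
      ((hYd i).hasFDerivAt.mul (aux_Tr σ x a hP))).fderiv
  have hT' := fun i : Fin 3 => congrArg (fun L : E3 →L[ℝ] ℝ => L (EuclideanSpace.single i 1)) (hT i)
  refine (Finset.sum_congr rfl fun i _ => hT' i).trans ?_
  have hp2 : ∀ k l i j, pd2 σ k l i j x
      = fderiv ℝ (pd σ l i j) x (EuclideanSpace.single k 1) := fun _ _ _ _ => rfl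
  have hr : (‖x‖ ^ 2)⁻¹ * (x 0 ^ 2 + x 1 ^ 2 + x 2 ^ 2) = 1 := by
    have : ‖x‖ ^ 2 = x 0 ^ 2 + x 1 ^ 2 + x 2 ^ 2 := by
      rw [EuclideanSpace.real_norm_sq_eq, Fin.sum_univ_three]
    rw [← this]
    exact inv_mul_cancel₀ (pow_ne_zero 2 (norm_ne_zero_iff.mpr hx0))
  simp only [ContinuousLinearMap.add_apply, ContinuousLinearMap.sub_apply,
    ContinuousLinearMap.smul_apply, ContinuousLinearMap.sum_apply, smul_eq_mul, hYf,
    fderiv_fun_const, Pi.zero_apply, ContinuousLinearMap.zero_apply, ← hp2]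
  have hs2 : ∀ k l i j, pd2 σ k l i j x = pd2 σ k l j i x := by
    intro k l i j
    rw [hp2, hp2, hsP]
  simp only [Dsig, D2sig, DsigTr, PiLp.smul_apply, smul_eq_mul]
  generalize (‖x‖ ^ 3)⁻¹ = r at *
  generalize (‖x‖ ^ 2)⁻¹ = s at *
  have e10 := fun k l => hs2 k l 1 0
  have e20 := fun k l => hs2 k l 2 0
  have e21 := fun k l => hs2 k l 2 1
  have f10 := fun k => hsP k 1 0
  have f20 := fun k => hsP k 2 0
  have f21 := fun k => hsP k 2 1
  clear hs2 hsP hp2 hT hT' hYf hYd hc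
  simp [Fin.sum_univ_three, Pi.single_apply, e10, e20, e21, f10, f20, f21]
  linear_combination (3 * r * (a 0 * (pd σ 0 0 0 x + pd σ 0 1 1 x + pd σ 0 2 2 x) + a 1 * (pd σ 1 0 0 x + pd σ 1 1 1 x + pd σ 1 2 2 x) + a 2 * (pd σ 2 0 0 x + pd σ 2 1 1 x + pd σ 2 2 2 x))) * hr
end

section
/- Let f : ℝ³ → ℝ be continuous with |f(x)| ≤ c(1 + |x|)⁻⁴ for some constant c > 0 and all x. Then for every fixed λ > 0 the function ξ ↦ ∫_{{x : |x − λξ| ≥ λ}} f(x) dx is continuously differentiable on ℝ³, and its partial derivatives are given by ∂/∂ξᵢ ∫_{{x : |x − λξ| ≥ λ}} f(x) dx = −λ ∫_{S_λ(λξ)} f(x) ν̄ᵢ(x) dμ̄(x) for i = 1, 2, 3. -/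
open MeasureTheory Metric

open Set Filter Topology

lemma polar_aux (φ : E3 → E3) (hφ : Integrable φ) :
    ∫ x, φ x = ∫ r in Ioi (0:ℝ), r ^ 2 • ∫ y : sphere (0 : E3) 1, φ (r • (y : E3)) ∂(volume : Measure E3).toSphere := by
  set σ := (volume : Measure E3).toSphere
  have hd : Module.finrank ℝ E3 - 1 = 2 := by simp
  have hmp := (volume : Measure E3).measurePreserving_homeomorphUnitSphereProd
  rw [hd] at hmp
  have hsymm : ∀ x : ({(0 : E3)}ᶜ : Set E3),
      ((homeomorphUnitSphereProd E3 x).2 : ℝ) • ((homeomorphUnitSphereProd E3 x).1 : E3) = x := by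
    intro x
    have := (homeomorphUnitSphereProd E3).symm_apply_apply x
    conv_rhs => rw [← this]
    rw [homeomorphUnitSphereProd_symm_apply_coe]
  let ψ : sphere (0:E3) 1 × Ioi (0:ℝ) → E3 := fun q => φ ((q.2 : ℝ) • (q.1 : E3))
  have h1 : ∫ x, φ x = ∫ q, ψ q ∂(σ.prod (Measure.volumeIoiPow 2)) := by
    rw [← hmp.integral_comp (Homeomorph.measurableEmbedding _) ψ]
    simp only [ψ, hsymm]
    rw [integral_subtype_comap (measurableSet_singleton _).compl φ, restrict_compl_singleton]
  have hint : Integrable ψ (σ.prod (Measure.volumeIoiPow 2)) := by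
    rw [← hmp.integrable_comp_emb (Homeomorph.measurableEmbedding _)]
    have : ψ ∘ (homeomorphUnitSphereProd E3) = φ ∘ Subtype.val := by
      funext x; simp only [ψ, Function.comp, hsymm]
    rw [this, ← integrableOn_iff_comap_subtypeVal (by measurability)]
    exact hφ.integrableOn
  rw [h1, integral_prod_symm _ hint]
  simp only [Measure.volumeIoiPow, ENNReal.ofReal]
  rw [integral_withDensity_eq_integral_smul,
    integral_subtype_comap measurableSet_Ioi fun a : ℝ ↦ Real.toNNReal (a ^ 2) • ∫ y : sphere (0 : E3) 1, φ (a • (y : E3)) ∂σ,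
        setIntegral_congr_fun measurableSet_Ioi fun x hx ↦ ?_]
  · rw [NNReal.smul_def, Real.coe_toNNReal _ (pow_nonneg hx.out.le _)]
  · exact (measurable_subtype_coe.pow_const _).real_toNNReal

/-- spherical moment -/
noncomputable def hmom (f : E3 → ℝ) (p : E3) (r : ℝ) : E3 :=
  r ^ 2 • ∫ y : sphere (0 : E3) 1, f (p + r • (y : E3)) • (y : E3) ∂(volume : Measure E3).toSphere

lemma hmom_cont (f : E3 → ℝ) (hf : Continuous f) : Continuous (fun q : E3 × ℝ => hmom f q.1 q.2) := by
  unfold hmom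
  refine (continuous_snd.pow 2).smul ?_
  have := continuous_parametric_integral_of_continuous (μ := (volume : Measure E3).toSphere)
    (f := fun (q : E3 × ℝ) (y : sphere (0 : E3) 1) => f (q.1 + q.2 • (y : E3)) • (y : E3)) (s := univ)
    (by simp only [Function.uncurry_def]; fun_prop) isCompact_univ
  simpa using this

/-- averaged moment -/
noncomputable def avmom (f : E3 → ℝ) (lam : ℝ) (p : E3) (ε : ℝ) : E3 :=
  ∫ u in Icc (0:ℝ) 1, deriv Real.smoothTransition u • hmom f p (√(lam ^ 2 - ε * u))

lemma dT_cont : Continuous (deriv Real.smoothTransition) :=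
  (Real.smoothTransition.contDiff (n := 1)).continuous_deriv (by simp)

lemma avmom_cont (f : E3 → ℝ) (hf : Continuous f) (lam : ℝ) :
    Continuous (fun q : E3 × ℝ => avmom f lam q.1 q.2) := by
  unfold avmom
  refine continuous_parametric_integral_of_continuous
    (f := fun (q : E3 × ℝ) (u : ℝ) => deriv Real.smoothTransition u • hmom f q.1 (√(lam ^ 2 - q.2 * u))) ?_ isCompact_Icc
  simp only [Function.uncurry_def]
  have h1 := dT_cont
  have h2 := (hmom_cont f hf).comp
    (f := fun z : (E3 × ℝ) × ℝ => (z.1.1, √(lam ^ 2 - z.1.2 * z.2))) (by fun_prop)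
  exact (h1.comp continuous_snd).smul h2

lemma avmom_zero (f : E3 → ℝ) (lam : ℝ) (hlam : 0 < lam) (p : E3) :
    avmom f lam p 0 = hmom f p lam := by
  unfold avmom
  simp only [zero_mul, sub_zero, Real.sqrt_sq hlam.le]
  rw [integral_smul_const, integral_Icc_eq_integral_Ioc, ← intervalIntegral.integral_of_le zero_le_one,
    intervalIntegral.integral_deriv_eq_sub]
  · simp
  · intro x _
    exact (Real.smoothTransition.contDiff (n := 1)).differentiable (by simp) x
  · exact dT_cont.intervalIntegrable _ _

lemma dT_zero (x : ℝ) (hx : x ≤ 0 ∨ 1 ≤ x) : deriv Real.smoothTransition x = 0 := by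
  rcases hx with hx | hx
  · refine IsLocalMin.deriv_eq_zero (Eventually.of_forall fun y => ?_)
    rw [Real.smoothTransition.zero_of_nonpos hx]
    exact Real.smoothTransition.nonneg y
  · refine IsLocalMax.deriv_eq_zero (Eventually.of_forall fun y => ?_)
    rw [Real.smoothTransition.one_of_one_le hx]
    exact Real.smoothTransition.le_one y

lemma f_int (f : E3 → ℝ) (hf : Continuous f) (c : ℝ)
    (hbound : ∀ x : E3, |f x| ≤ c * ((1 + ‖x‖) ^ 4)⁻¹) : Integrable f := by
  have h := (integrable_one_add_norm (E := E3) (μ := volume) (r := 4) (by simp; norm_num)).const_mul c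
  refine h.mono' hf.aestronglyMeasurable (Eventually.of_forall fun x => ?_)
  have h0 : 0 ≤ 1 + ‖x‖ := by positivity
  have := hbound x
  rw [Real.rpow_neg h0]
  exact_mod_cast this

lemma radial_subst (f : E3 → ℝ) (hf : Continuous f) (lam : ℝ) (hlam : 0 < lam) (p : E3) (ε : ℝ)
    (hε : 0 < ε) (hε' : ε ≤ lam ^ 2) :
    ∫ r in Ioi (0:ℝ), (deriv Real.smoothTransition ((lam ^ 2 - r ^ 2) / ε) * (2 * r / ε)) • hmom f p r
      = avmom f lam p ε := by
  set a := √(lam ^ 2 - ε) with ha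
  have ha2 : a ^ 2 = lam ^ 2 - ε := Real.sq_sqrt (by linarith)
  have ha0 : 0 ≤ a := Real.sqrt_nonneg _
  have hal : a ≤ lam := by nlinarith
  have h1 : ∫ r in Ioi (0:ℝ), (deriv Real.smoothTransition ((lam ^ 2 - r ^ 2) / ε) * (2 * r / ε)) • hmom f p r
      = ∫ r in Ioc a lam, (deriv Real.smoothTransition ((lam ^ 2 - r ^ 2) / ε) * (2 * r / ε)) • hmom f p r := by
    refine setIntegral_eq_of_subset_of_forall_sdiff_eq_zero measurableSet_Ioi
      (fun r hr => lt_of_le_of_lt ha0 hr.1) ?_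
    rintro r ⟨hr0, hr⟩
    have hr0 : 0 < r := hr0
    rw [dT_zero, zero_mul, zero_smul]
    by_cases h : a < r
    · left
      have : lam < r := by
        by_contra hh
        exact hr ⟨h, not_lt.1 hh⟩
      exact div_nonpos_of_nonpos_of_nonneg (by nlinarith) hε.le
    · right
      rw [le_div_iff₀ hε]
      nlinarith
  have h2 := hmom_cont f hf
  have h3 := intervalIntegral.integral_deriv_smul_comp (a := a) (b := lam)
    (f := fun r => (lam ^ 2 - r ^ 2) / ε) (f' := fun r => - (2 * r / ε))
    (g := fun u => deriv Real.smoothTransition u • hmom f p (√(lam ^ 2 - ε * u)))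
    (fun x _ => by
      have := (((hasDerivAt_id x).pow 2).const_sub (lam ^ 2)).div_const ε
      convert! this using 1
      simp; ring)
    (by fun_prop)
    (dT_cont.smul (h2.comp (f := fun u : ℝ => (p, √(lam ^ 2 - ε * u))) (by fun_prop)))
  rw [h1, ← intervalIntegral.integral_of_le hal]
  have e1 : (lam ^ 2 - a ^ 2) / ε = 1 := by rw [ha2]; field_simp; ring
  have e2 : (lam ^ 2 - lam ^ 2) / ε = 0 := by simp
  simp only [] at h3
  rw [e1, e2, intervalIntegral.integral_symm 0 1, intervalIntegral.integral_of_le zero_le_one,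
    ← integral_Icc_eq_integral_Ioc] at h3
  unfold avmom
  rw [← neg_inj, ← h3, ← intervalIntegral.integral_neg]
  refine intervalIntegral.integral_congr fun r hr => ?_
  rw [uIcc_of_le hal] at hr
  have hr0 : 0 ≤ r := ha0.trans hr.1
  have : lam ^ 2 - ε * ((lam ^ 2 - r ^ 2) / ε) = r ^ 2 := by field_simp; ring
  simp only [Function.comp, this, Real.sqrt_sq hr0, smul_smul, ← neg_smul]
  congr 1; ring

/-- cutoff -/
noncomputable def cut (lam ε : ℝ) (x : E3) : ℝ := Real.smoothTransition ((lam ^ 2 - ‖x‖ ^ 2) / ε)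

lemma cut_contDiff (lam ε : ℝ) : ContDiff ℝ 1 (cut lam ε) := by
  unfold cut
  refine (Real.smoothTransition.contDiff (n := 1)).comp ?_
  exact (contDiff_const.sub (contDiff_norm_sq ℝ)).div_const _

lemma cut_zero (lam ε : ℝ) (hlam : 0 < lam) (hε : 0 < ε) (x : E3) (hx : lam ≤ ‖x‖) : cut lam ε x = 0 := by
  refine Real.smoothTransition.zero_of_nonpos (div_nonpos_of_nonpos_of_nonneg (by nlinarith) hε.le)

lemma cut_supp (lam ε : ℝ) (hlam : 0 < lam) (hε : 0 < ε) : HasCompactSupport (cut lam ε) := by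
  refine HasCompactSupport.intro (isCompact_closedBall (0 : E3) lam) fun x hx => ?_
  refine cut_zero lam ε hlam hε x ?_
  simp at hx
  exact hx.le

lemma cut_fderiv (lam ε : ℝ) (x v : E3) : fderiv ℝ (cut lam ε) x v =
    deriv Real.smoothTransition ((lam ^ 2 - ‖x‖ ^ 2) / ε) * (-(2 / ε)) * inner ℝ x v := by
  have h1 : HasFDerivAt (fun x : E3 => (lam ^ 2 - ‖x‖ ^ 2) * ε⁻¹) _ x :=
    ((hasStrictFDerivAt_norm_sq x).hasFDerivAt.const_sub (lam ^ 2)).mul_const ε⁻¹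
  have h2 : HasDerivAt Real.smoothTransition _ ((lam ^ 2 - ‖x‖ ^ 2) * ε⁻¹) :=
    ((Real.smoothTransition.contDiff (n := 1)).differentiable (by simp) _).hasDerivAt
  have h3 := (h2.comp_hasFDerivAt x h1).fderiv
  have : cut lam ε = Real.smoothTransition ∘ (fun x : E3 => (lam ^ 2 - ‖x‖ ^ 2) * ε⁻¹) := by
    funext x; simp [cut, div_eq_mul_inv]
  rw [this, h3]
  simp [div_eq_mul_inv]
  ring

lemma mollified (f : E3 → ℝ) (hf : Continuous f) (lam : ℝ) (hlam : 0 < lam) (p : E3) (ε : ℝ)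
    (hε : 0 < ε) (hε' : ε ≤ lam ^ 2) :
    HasFDerivAt (fun p => ∫ t, f t * cut lam ε (p - t)) (innerSL ℝ (avmom f lam p ε)) p := by
  have hs := cut_supp lam ε hlam hε
  have hc := cut_contDiff lam ε
  have key := hs.hasFDerivAt_convolution_right (ContinuousLinearMap.mul ℝ ℝ) (μ := volume)
    hf.locallyIntegrable hc p
  refine key.congr_fderiv ?_
  ext1 v
  rw [convolution_precompR_apply _ hf.locallyIntegrable (hs.fderiv ℝ) (hc.continuous_fderiv one_ne_zero)]
  let φ : E3 → E3 := fun x =>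
    (f (p + x) * deriv Real.smoothTransition ((lam ^ 2 - ‖x‖ ^ 2) / ε) * (2 / ε)) • x
  have hT := dT_cont
  have hφc : Continuous φ := by
    simp only [φ]
    fun_prop
  have hφs : HasCompactSupport φ := by
    refine HasCompactSupport.intro (isCompact_closedBall (0 : E3) lam) fun x hx => ?_
    simp at hx
    simp only [φ]
    rw [dT_zero _ (Or.inl (div_nonpos_of_nonpos_of_nonneg (by nlinarith) hε.le))]
    simp
  have hφ : Integrable φ := hφc.integrable_of_hasCompactSupport hφs
  have h1 : ∫ x, φ x = avmom f lam p ε := by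
    rw [polar_aux φ hφ, ← radial_subst f hf lam hlam p ε hε hε']
    refine setIntegral_congr_fun measurableSet_Ioi fun r hr => ?_
    have hr : 0 < r := hr
    simp only [φ, hmom]
    rw [smul_comm]
    congr 1
    rw [← integral_smul]
    refine integral_congr_ae (Eventually.of_forall fun y => ?_)
    have : ‖(y : E3)‖ = 1 := by simpa using y.2
    simp only [norm_smul, this, smul_smul, Real.norm_eq_abs, mul_one, sq_abs]
    congr 1; ring
  rw [← h1]
  simp only [convolution_def, ContinuousLinearMap.mul_apply', innerSL_apply_apply]
  rw [real_inner_comm, ← integral_inner hφ,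
    ← integral_add_left_eq_self (fun t => f t * (fderiv ℝ (cut lam ε) (p - t)) v) p]
  refine integral_congr_ae (Eventually.of_forall fun x => ?_)
  simp only [φ, cut_fderiv, inner_smul_right]
  rw [show p - (p + x) = -x by abel, norm_neg, inner_neg_left, real_inner_comm]
  ring

lemma ball_deriv (f : E3 → ℝ) (hf : Continuous f) (hfi : Integrable f) (lam : ℝ) (hlam : 0 < lam) (p : E3) :
    HasFDerivAt (fun p => ∫ t in ball p lam, f t) (innerSL ℝ (hmom f p lam)) p := by
  have hav := avmom_cont f hf lam
  refine hasFDerivAt_of_tendstoUniformlyOnFilter (l := 𝓝[>] (0:ℝ))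
    (f := fun ε p => ∫ t, f t * cut lam ε (p - t))
    (f' := fun ε p => innerSL ℝ (avmom f lam p ε)) (g' := fun p => innerSL ℝ (hmom f p lam)) ?_ ?_ ?_
  · rw [tendstoUniformlyOnFilter_iff_tendsto]
    have hcL : Continuous fun q : ℝ × E3 => ((innerSL ℝ (avmom f lam q.2 0) : E3 →L[ℝ] ℝ), (innerSL ℝ (avmom f lam q.2 q.1) : E3 →L[ℝ] ℝ)) := by
      have h1 := hav.comp (f := fun q : ℝ × E3 => (q.2, (0:ℝ))) (by fun_prop)
      have h2 := hav.comp (f := fun q : ℝ × E3 => (q.2, q.1)) (by fun_prop)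
      exact ((innerSL ℝ).continuous.comp h1).prodMk ((innerSL ℝ).continuous.comp h2)
    have ht := hcL.tendsto ((0:ℝ), p)
    simp only [avmom_zero f lam hlam] at ht
    refine (ht.mono_left ?_).mono_right (nhds_le_uniformity _)
    rw [nhds_prod_eq]
    exact Filter.prod_mono nhdsWithin_le_nhds le_rfl
  · have : ∀ᶠ ε in 𝓝[>] (0:ℝ), 0 < ε ∧ ε ≤ lam ^ 2 := by
      filter_upwards [Ioc_mem_nhdsGT (show (0:ℝ) < lam ^ 2 by positivity)] with ε hε using hε
    filter_upwards [this.prod_inl (𝓝 p)] with q hq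
    exact mollified f hf lam hlam q.2 q.1 hq.1 hq.2
  · refine Eventually.of_forall fun q => ?_
    rw [← integral_indicator measurableSet_ball]
    refine tendsto_integral_filter_of_dominated_convergence (fun t => ‖f t‖) ?_ ?_ hfi.norm ?_
    · refine Eventually.of_forall fun ε => ?_
      have := (cut_contDiff lam ε).continuous
      exact (hf.mul (this.comp (by fun_prop))).aestronglyMeasurable
    · refine Eventually.of_forall fun ε => Eventually.of_forall fun t => ?_
      rw [norm_mul]
      refine mul_le_of_le_one_right (norm_nonneg _) ?_
      rw [Real.norm_eq_abs, cut, abs_of_nonneg (Real.smoothTransition.nonneg _)]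
      exact Real.smoothTransition.le_one _
    · refine Eventually.of_forall fun t => ?_
      refine tendsto_const_nhds.congr' ?_
      by_cases ht : t ∈ ball q lam
      · rw [indicator_of_mem ht]
        rw [mem_ball, dist_comm, dist_eq_norm] at ht
        have h0 : 0 < lam ^ 2 - ‖q - t‖ ^ 2 := by nlinarith [norm_nonneg (q - t)]
        filter_upwards [Ioc_mem_nhdsGT h0] with ε hε
        have : cut lam ε (q - t) = 1 :=
          Real.smoothTransition.one_of_one_le ((one_le_div hε.1).2 hε.2)
        rw [this, mul_one]
      · rw [indicator_of_notMem ht]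
        rw [mem_ball, dist_comm, dist_eq_norm, not_lt] at ht
        filter_upwards [self_mem_nhdsWithin] with ε hε
        rw [cut_zero lam ε hlam hε _ ht, mul_zero]

theorem stmt18 (f : E3 → ℝ) (hf : Continuous f) (c : ℝ) (hc : 0 < c)
    (hbound : ∀ x : E3, |f x| ≤ c * ((1 + ‖x‖) ^ 4)⁻¹)
    (lam : ℝ) (hlam : 0 < lam) :
    ContDiff ℝ 1 (fun ξ : E3 => ∫ x in {x : E3 | lam ≤ ‖x - lam • ξ‖}, f x) ∧
      ∀ ξ : E3, ∀ i : Fin 3,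
        fderiv ℝ (fun ξ' : E3 => ∫ x in {x : E3 | lam ≤ ‖x - lam • ξ'‖}, f x) ξ
            (EuclideanSpace.single i 1) =
          -lam *
            sphereIntegral lam (lam • ξ)
              (fun x => f x * (lam⁻¹ • (x - lam • ξ) : E3) i) := by
  have hfi := f_int f hf c hbound
  have hF : (fun ξ : E3 => ∫ x in {x : E3 | lam ≤ ‖x - lam • ξ‖}, f x) =
      fun ξ : E3 => (∫ x, f x) - ∫ t in ball (lam • ξ) lam, f t := by
    funext ξ
    rw [← integral_add_compl (measurableSet_ball (x := lam • ξ) (ε := lam)) hfi, add_sub_cancel_left]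
    congr 2
    ext x
    simp [dist_eq_norm]
  have hD : ∀ ξ : E3, HasFDerivAt (fun ξ : E3 => ∫ x in {x : E3 | lam ≤ ‖x - lam • ξ‖}, f x)
      (-(lam • (innerSL ℝ (hmom f (lam • ξ) lam) : E3 →L[ℝ] ℝ))) ξ := by
    intro ξ
    rw [hF]
    have h1 : HasFDerivAt (fun ξ : E3 => lam • ξ) (lam • ContinuousLinearMap.id ℝ E3) ξ :=
      (hasFDerivAt_id ξ).const_smul lam
    have h2 := ((ball_deriv f hf hfi lam hlam (lam • ξ)).comp ξ h1).const_sub (∫ x, f x)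
    refine h2.congr_fderiv ?_
    ext v
    simp
  constructor
  · rw [contDiff_one_iff_fderiv]
    refine ⟨fun ξ => (hD ξ).differentiableAt, ?_⟩
    rw [show fderiv ℝ (fun ξ : E3 => ∫ x in {x : E3 | lam ≤ ‖x - lam • ξ‖}, f x) = _ from
      funext fun ξ => (hD ξ).fderiv]
    have h1 := (hmom_cont f hf).comp (f := fun ξ : E3 => (lam • ξ, lam)) (by fun_prop)
    exact (((innerSL ℝ).continuous.comp h1).const_smul lam).neg
  · intro ξ i
    rw [(hD ξ).fderiv]
    simp only [ContinuousLinearMap.neg_apply, ContinuousLinearMap.smul_apply, innerSL_apply_apply,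
      smul_eq_mul, sphereIntegral, neg_mul]
    congr 2
    rw [hmom, real_inner_smul_left]
    congr 1
    have hi : Integrable (fun y : sphere (0 : E3) 1 => f (lam • ξ + lam • (y : E3)) • (y : E3))
        (volume : Measure E3).toSphere :=
      Continuous.integrable_of_hasCompactSupport (by fun_prop) (HasCompactSupport.of_compactSpace _)
    rw [real_inner_comm, ← integral_inner hi]
    refine integral_congr_ae (Eventually.of_forall fun y => ?_)
    simp only [add_sub_cancel_left, inv_smul_smul₀ hlam.ne', inner_smul_right,
      EuclideanSpace.inner_single_left]
    simp
end
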